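/- Let n ∈ ℕ and for each i ∈ {1,…,n} let ψ_i(q) = q^{-τ_{ψ_i}} and φ_i(q) = q^{-τ_{φ_i}} with τ_{ψ_i}, τ_{φ_i} ∈ ℝ_{>0}, and assume Σ_{i=1}^n τ_{ψ_i} ≥ 1. Then for each fixed j ∈ {1,…,n}, the Hausdorff dimension of W̃_n^j(Ψ,Φ) = limsup_{q→∞} ∪_{0 ≤ ‖p‖ ≤ q} R_{p,q}^{j,+}(Ψ,Φ) is at least min_{k(j)=1,…,n} { (n + 1 + Σ_{i≠j : τ_{ψ_i} < τ_{k(j)}} (τ_{k(j)} - τ_{ψ_i}) + max{0, τ_{k(j)} - τ_{ψ_j} - τ_{φ_j}}) / (1 + τ_{k(j)}) }, where τ_{k(j)} = τ_{ψ_j} + τ_{φ_j} if k(j) = j and τ_{k(j)} = τ_{ψ_{k(j)}} otherwise. -/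

import Mathlib

open MeasureTheory Filter Set

/-- The unit cube `[0,1]^n` in `ℝ^n` (with the maximum norm). -/
def unitCube (n : ℕ) : Set (Fin n → ℝ) := Set.univ.pi fun _ => Set.Icc (0 : ℝ) 1

/-- `W_n(Ψ, Φ)`: the set of `x ∈ [0,1]^n` such that, for infinitely many
`(p,q) ∈ ℤ^n × ℕ`, one has `|x_i - p_i/q| < ψ_i(q)/q` for every `i` and
`|x_j - p_j/q| > (1 - φ_j(q))·ψ_j(q)/q` for some `j`. -/
def Wweighted (n : ℕ) (Ψ Φ : Fin n → ℕ → ℝ) : Set (Fin n → ℝ) :=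
  {x ∈ unitCube n |
    {pq : (Fin n → ℤ) × ℕ | 0 < pq.2 ∧
      (∀ i, |x i - (pq.1 i : ℝ) / pq.2| < Ψ i pq.2 / pq.2) ∧
      (∃ j, (1 - Φ j pq.2) * (Ψ j pq.2 / pq.2) < |x j - (pq.1 j : ℝ) / pq.2|)}.Infinite}

/-- `τ_{k(j)}`: equals `τ_{ψ_j} + τ_{φ_j}` if `k = j`, and `τ_{ψ_k}` otherwise. -/
noncomputable def tauK {n : ℕ} (τψ τφ : Fin n → ℝ) (j k : Fin n) : ℝ :=
  if k = j then τψ j + τφ j else τψ k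

open scoped Classical in
/-- The quantity
`(n + 1 + Σ_{i ≠ j : τ_{ψ_i} < τ_{k(j)}}(τ_{k(j)} - τ_{ψ_i}) + max{0, τ_{k(j)} - τ_{ψ_j} - τ_{φ_j}}) / (1 + τ_{k(j)})`. -/
noncomputable def dimExpr (n : ℕ) (τψ τφ : Fin n → ℝ) (j k : Fin n) : ℝ :=
  ((n : ℝ) + 1 +
      (∑ i ∈ Finset.univ.filter fun i => i ≠ j ∧ τψ i < tauK τψ τφ j k,
        (tauK τψ τφ j k - τψ i)) +
      max 0 (tauK τψ τφ j k - τψ j - τφ j)) /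
    (1 + tauK τψ τφ j k)

/-- The shifted hyperrectangle `R_{p,q}^{j,+}(Ψ,Φ)`: in coordinate `j` it is the interval
centred at `p_j/q + (2-φ_j(q))ψ_j(q)/(2q)` of radius `φ_j(q)ψ_j(q)/(2q)`, and in every
other coordinate `i` it is the interval centred at `p_i/q` of radius `ψ_i(q)/q`. -/
def Rplus (n : ℕ) (Ψ Φ : Fin n → ℕ → ℝ) (j : Fin n) (p : Fin n → ℤ) (q : ℕ) :
    Set (Fin n → ℝ) :=
  Set.univ.pi fun i =>
    if i = j then
      Set.Ioo
        ((p j : ℝ) / q + (2 - Φ j q) * Ψ j q / (2 * q) - Φ j q * Ψ j q / (2 * q))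
        ((p j : ℝ) / q + (2 - Φ j q) * Ψ j q / (2 * q) + Φ j q * Ψ j q / (2 * q))
    else
      Set.Ioo ((p i : ℝ) / q - Ψ i q / q) ((p i : ℝ) / q + Ψ i q / q)

/-- `W̃_n^j(Ψ,Φ) = limsup_{q→∞} ⋃_{0 ≤ ‖p‖ ≤ q} R_{p,q}^{j,+}(Ψ,Φ)`. -/
def Wtilde (n : ℕ) (Ψ Φ : Fin n → ℕ → ℝ) (j : Fin n) : Set (Fin n → ℝ) :=
  limsup (fun q : ℕ => ⋃ p ∈ {p : Fin n → ℤ | ‖p‖ ≤ (q : ℝ)}, Rplus n Ψ Φ j p q) atTop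


/-- A cover by sets with locally controlled masses has large `s`-dimensional premeasure. -/
theorem exists_isOpen_cover_le {n : ℕ} {s : ℝ} (hs : 0 < s) (t : Set (Fin n → ℝ))
    (ht : Metric.ediam t ≤ 1 / 2) {η : ENNReal} (hη : 0 < η) {C : ENNReal} (hC : C ≠ ⊤) :
    ∃ U : Set (Fin n → ℝ), IsOpen U ∧ t ⊆ U ∧ ∀ μ : Measure (Fin n → ℝ),
      (∀ x r, 0 < r → r ≤ 1 → μ (Metric.closedBall x r) ≤ C * ENNReal.ofReal r ^ s) →
      μ U ≤ C * (⨆ _ : t.Nonempty, Metric.ediam t ^ s) + η := by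
  rcases t.eq_empty_or_nonempty with rfl | hne
  · exact ⟨∅, isOpen_empty, subset_rfl, fun μ _ => by simp⟩
  obtain ⟨x, hx⟩ := hne
  have htop : Metric.ediam t ≠ ⊤ := ne_top_of_le_ne_top (by norm_num) ht
  set d := (Metric.ediam t).toReal with hd
  have hd2 : d ≤ 1 / 2 := by
    have := ENNReal.toReal_mono (by norm_num) ht
    simpa using this
  have hofd : ENNReal.ofReal d = Metric.ediam t := ENNReal.ofReal_toReal htop
  have hcont : Tendsto (fun ρ : ℝ => C * ENNReal.ofReal ρ ^ s) (nhdsWithin d (Ioi d))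
      (nhds (C * ENNReal.ofReal d ^ s)) := by
    refine Tendsto.mono_left ?_ nhdsWithin_le_nhds
    refine ENNReal.Tendsto.const_mul ?_ (Or.inr hC)
    exact ((ENNReal.continuous_rpow_const (y := s)).comp ENNReal.continuous_ofReal).tendsto d
  have hlt : C * ENNReal.ofReal d ^ s < C * ENNReal.ofReal d ^ s + η := by
    refine ENNReal.lt_add_right ?_ hη.ne'
    exact ENNReal.mul_ne_top hC (ENNReal.rpow_ne_top_of_nonneg hs.le ENNReal.ofReal_ne_top)
  have h1 := hcont.eventually (gt_mem_nhds hlt)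
  have h2 : ∀ᶠ ρ in nhdsWithin d (Ioi d), ρ < 1 :=
    nhdsWithin_le_nhds (gt_mem_nhds (by linarith))
  have h3 : ∀ᶠ ρ in nhdsWithin d (Ioi d), d < ρ := eventually_mem_nhdsWithin
  obtain ⟨ρ, hρ1, hρ2, hρ3⟩ := (h1.and (h2.and h3)).exists
  have hd0 : 0 ≤ d := ENNReal.toReal_nonneg
  refine ⟨Metric.ball x ρ, Metric.isOpen_ball, fun y hy => ?_, fun μ hμ => ?_⟩
  · rw [Metric.mem_ball]
    refine lt_of_le_of_lt ?_ hρ3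
    rw [dist_edist]
    exact ENNReal.toReal_mono htop (Metric.edist_le_ediam_of_mem hy hx)
  · have hne : t.Nonempty := ⟨x, hx⟩
    simp only [hne, ciSup_pos]
    calc μ (Metric.ball x ρ) ≤ μ (Metric.closedBall x ρ) := measure_mono Metric.ball_subset_closedBall
      _ ≤ C * ENNReal.ofReal ρ ^ s := hμ x ρ (by linarith) hρ2.le
      _ ≤ C * ENNReal.ofReal d ^ s + η := hρ1.le
      _ = _ := by rw [hofd]

/-- A mass distribution principle for a decreasing sequence of compact sets carrying measures
with a uniform Frostman bound. -/
theorem le_dimH_iInter_of_measures {n : ℕ} {s : ℝ} (hs : 0 < s) {C : ENNReal} (hC : C ≠ ⊤)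
    (X : ℕ → Set (Fin n → ℝ)) (hX : Antitone X) (hXc : ∀ k, IsCompact (X k))
    (μ : ℕ → Measure (Fin n → ℝ))
    (hball : ∀ k x r, 0 < r → r ≤ 1 → μ k (Metric.closedBall x r) ≤ C * ENNReal.ofReal r ^ s)
    (hmass : ∀ k, 1 / 2 ≤ μ k (X k)) :
    ENNReal.ofReal s ≤ dimH (⋂ k, X k) := by
  have key : ∀ t : ℕ → Set (Fin n → ℝ), (⋂ k, X k) ⊆ ⋃ i, t i →
      (∀ i, Metric.ediam (t i) ≤ 1 / 2) →
      1 / 4 ≤ C * ∑' i, ⨆ _ : (t i).Nonempty, Metric.ediam (t i) ^ s := by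
    intro t hcov hdiam
    obtain ⟨η, hη, hηsum⟩ := ENNReal.exists_pos_sum_of_countable
      (show (1 / 4 : ENNReal) ≠ 0 by norm_num) ℕ
    choose U hUo hU hUμ using fun i => exists_isOpen_cover_le hs (t i) (hdiam i)
      (ENNReal.coe_pos.2 (hη i)) hC
    obtain ⟨k, hk⟩ := exists_subset_nhds_of_isCompact (V := X) (U := ⋃ i, U i)
      (directed_of_isDirected_le hX) hXc (fun x hx => by
        refine (isOpen_iUnion hUo).mem_nhds ?_
        obtain ⟨i, hi⟩ := mem_iUnion.1 (hcov hx)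
        exact mem_iUnion.2 ⟨i, hU i hi⟩)
    have h : (1 / 2 : ENNReal) ≤
        C * (∑' i, ⨆ _ : (t i).Nonempty, Metric.ediam (t i) ^ s) + 1 / 4 :=
      calc (1 / 2 : ENNReal) ≤ μ k (X k) := hmass k
        _ ≤ μ k (⋃ i, U i) := measure_mono hk
        _ ≤ ∑' i, μ k (U i) := measure_iUnion_le _
        _ ≤ ∑' i, (C * (⨆ _ : (t i).Nonempty, Metric.ediam (t i) ^ s) + η i) :=
          ENNReal.tsum_le_tsum fun i => hUμ i (μ k) (hball k)
        _ = C * (∑' i, ⨆ _ : (t i).Nonempty, Metric.ediam (t i) ^ s) + ∑' i, (η i : ENNReal) := by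
          rw [ENNReal.tsum_add, ENNReal.tsum_mul_left]
        _ ≤ _ := by gcongr
    have e : (1 / 2 : ENNReal) = 1 / 4 + 1 / 4 := by
      rw [← ENNReal.toReal_eq_toReal_iff' (by norm_num) (by norm_num),
        ENNReal.toReal_add (by norm_num) (by norm_num)]
      norm_num
    rw [e] at h
    exact (ENNReal.add_le_add_iff_right (by norm_num)).1 h
  have hpos : μH[s] (⋂ k, X k) ≠ 0 := by
    intro h0
    rw [Measure.hausdorffMeasure_apply] at h0
    have h1 := (ENNReal.iSup_eq_zero.1 h0) (1 / 2)
    have h2 := (ENNReal.iSup_eq_zero.1 h1) (by norm_num)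
    have hCpos : C ≠ 0 := by
      rintro rfl
      have h3 := hmass 0
      have h4 : μ 0 (X 0) = 0 := by
        refine (measure_null_of_locally_null _ fun x _ => ⟨Metric.closedBall x 1, ?_, ?_⟩)
        · exact mem_nhdsWithin_of_mem_nhds (Metric.closedBall_mem_nhds x one_pos)
        · simpa using hball 0 x 1 one_pos le_rfl
      rw [h4] at h3
      norm_num at h3
    have hlt : (⨅ (t : ℕ → Set (Fin n → ℝ)) (_ : (⋂ k, X k) ⊆ ⋃ i, t i)
        (_ : ∀ i, Metric.ediam (t i) ≤ 1 / 2),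
        ∑' i, ⨆ _ : (t i).Nonempty, Metric.ediam (t i) ^ s) < (1 / 4) / C := by
      rw [h2]
      exact ENNReal.div_pos (by norm_num) hC
    simp only [iInf_lt_iff] at hlt
    obtain ⟨t, ht1, ht2, ht3⟩ := hlt
    have h5 := key t ht1 ht2
    rw [ENNReal.lt_div_iff_mul_lt (Or.inl hCpos) (Or.inl hC), mul_comm] at ht3
    exact absurd h5 (not_le.2 ht3)
  have := le_dimH_of_hausdorffMeasure_ne_zero (d := s.toNNReal) (s := ⋂ k, X k) (by
    rwa [Real.coe_toNNReal s hs.le])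
  simpa [ENNReal.ofReal] using this

/-- If continuous compactly supported densities can be localised to the sets `E q`, `q ≥ N`, while
increasing the masses of balls by arbitrarily little compared to `r ^ s`, then the limsup set of
`E` has dimension at least `s`. -/
theorem le_dimH_limsup_of_localisation {n : ℕ} {s : ℝ} (hs : 0 < s) (hsn : s ≤ n)
    (E : ℕ → Set (Fin n → ℝ))
    (H : ∀ g : (Fin n → ℝ) → ℝ, Continuous g → HasCompactSupport g → (∀ x, 0 ≤ g x) →
      ∀ ε : ℝ, 0 < ε → ∀ N : ℕ, ∃ f : (Fin n → ℝ) → ℝ, Continuous f ∧ (∀ x, 0 ≤ f x) ∧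
        ∃ T : Set (Fin n → ℝ), IsCompact T ∧ (T ⊆ ⋃ q ≥ N, E q) ∧ (∀ x ∉ T, f x = 0) ∧
          (∀ x r, 0 < r → r ≤ 1 → ∫ y in Metric.closedBall x r, g y * f y ≤
            (∫ y in Metric.closedBall x r, g y) + ε * r ^ s) ∧
          (∫ y in unitCube n, g y) - ε ≤ ∫ y in unitCube n, g y * f y) :
    ENNReal.ofReal s ≤ dimH (limsup E atTop) := by
  let St := {p : ((Fin n → ℝ) → ℝ) × Set (Fin n → ℝ) //
    Continuous p.1 ∧ IsCompact p.2 ∧ (∀ x, 0 ≤ p.1 x) ∧ ∀ x ∉ p.2, p.1 x = 0}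
  have step : ∀ (p : St) (k : ℕ), ∃ p' : St, p'.1.2 ⊆ p.1.2 ∧ (p'.1.2 ⊆ ⋃ q ≥ k, E q) ∧
      (∀ x r, 0 < r → r ≤ 1 → ∫ y in Metric.closedBall x r, p'.1.1 y ≤
            (∫ y in Metric.closedBall x r, p.1.1 y) + (1 / 2) ^ (k + 2) * r ^ s) ∧
          (∫ y in unitCube n, p.1.1 y) - (1 / 2) ^ (k + 2) ≤ ∫ y in unitCube n, p'.1.1 y := by
    rintro ⟨⟨g, X⟩, hg, hX, hg0, hgX⟩ k
    obtain ⟨f, hf, hf0, T, hT, hTE, hfT, h1, h2⟩ := H g hg (HasCompactSupport.intro hX hgX) hg0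
      ((1 / 2) ^ (k + 2)) (by positivity) k
    refine ⟨⟨⟨fun y => g y * f y, X ∩ T⟩, hg.mul hf, hX.inter hT,
      fun x => mul_nonneg (hg0 x) (hf0 x), fun x hx => ?_⟩, inter_subset_left,
      inter_subset_right.trans hTE, h1, h2⟩
    by_cases hxX : x ∈ X
    · have : x ∉ T := fun h => hx ⟨hxX, h⟩
      simp [hfT x this]
    · have : g x = 0 := hgX x hxX
      simp [this]
  choose nxt hn1 hn2 hn3 hn4 using step
  let p0 : St := ⟨⟨fun x => max 0 (min 1 (2 - ‖x‖)), Metric.closedBall 0 2⟩, by fun_prop,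
    isCompact_closedBall _ _, fun x => le_max_left _ _, fun x hx => by
      rw [mem_closedBall_zero_iff, not_le] at hx
      exact max_eq_left ((min_le_right _ _).trans (by linarith))⟩
  let S : ℕ → St := fun k => Nat.rec p0 (fun k p => nxt p k) k
  have hS : ∀ k, S (k + 1) = nxt (S k) k := fun k => rfl
  have hInt : ∀ k, Integrable (S k).1.1 := fun k =>
    (S k).2.1.integrable_of_hasCompactSupport (HasCompactSupport.intro (S k).2.2.1 (S k).2.2.2.2)
  have hup : ∀ k x r, 0 < r → r ≤ 1 → ∫ y in Metric.closedBall x r, (S k).1.1 y ≤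
      (2 ^ n + 1 - (1 / 2) ^ k) * r ^ s := by
    intro k
    induction k with
    | zero =>
      intro x r hr hr1
      have h1 : ∫ y in Metric.closedBall x r, (S 0).1.1 y ≤
          ∫ y in Metric.closedBall x r, (1 : ℝ) := by
        refine setIntegral_mono (hInt 0).integrableOn ?_ fun y => ?_
        · exact (integrableOn_const_iff).2 (Or.inr measure_closedBall_lt_top)
        · exact max_le zero_le_one (min_le_left _ _)
      have h2 : ∫ y in Metric.closedBall x r, (1 : ℝ) = (2 * r) ^ n := by
        simp [Measure.real, Real.volume_pi_closedBall x hr.le, hr.le]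
      have h3 : r ^ (n : ℝ) ≤ r ^ s := Real.rpow_le_rpow_of_exponent_ge hr hr1 hsn
      rw [Real.rpow_natCast] at h3
      calc _ ≤ (2 * r) ^ n := h1.trans h2.le
        _ = 2 ^ n * r ^ n := mul_pow _ _ _
        _ ≤ 2 ^ n * r ^ s := by gcongr
        _ = _ := by ring
    | succ k ih =>
      intro x r hr hr1
      have h1 := hn3 (S k) k x r hr hr1
      have h2 := ih x r hr hr1
      have h3 : (0 : ℝ) ≤ r ^ s := Real.rpow_nonneg hr.le _
      rw [hS]
      have h4 : (0 : ℝ) ≤ (1 / 2) ^ k := by positivity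
      refine h1.trans ?_
      rw [pow_succ, pow_succ]
      nlinarith [mul_nonneg h3 h4]
  have hlow : ∀ k, 1 / 2 + (1 / 2) ^ (k + 1) ≤ ∫ y in unitCube n, (S k).1.1 y := by
    intro k
    induction k with
    | zero =>
      have h1 : ∫ y in unitCube n, (S 0).1.1 y = ∫ y in unitCube n, (1 : ℝ) := by
        refine setIntegral_congr_fun (MeasurableSet.univ_pi fun _ => measurableSet_Icc) ?_
        intro y hy
        have : ‖y‖ ≤ 1 := (pi_norm_le_iff_of_nonneg zero_le_one).2 fun i => by
          have := hy i (mem_univ i)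
          rw [Real.norm_eq_abs, abs_le]
          exact ⟨by linarith [this.1], this.2⟩
        change max 0 (min 1 (2 - ‖y‖)) = 1
        rw [min_eq_left (by linarith), max_eq_right zero_le_one]
      rw [h1]
      have h2 : volume (unitCube n) = 1 := by
        rw [unitCube, volume_pi_pi]
        simp
      simp only [setIntegral_const, Measure.real, h2]
      norm_num
    | succ k ih =>
      have h1 := hn4 (S k) k
      rw [hS]
      refine le_trans ?_ h1
      have : (1 / 2 : ℝ) ^ (k + 1) = 2 * (1 / 2) ^ (k + 2) := by ring
      have h3 : k + 1 + 1 = k + 2 := rfl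
      rw [h3]
      linarith
  set C : ℝ := 2 ^ n + 1
  have hC0 : 0 ≤ C := by positivity
  let μ : ℕ → Measure (Fin n → ℝ) := fun k => volume.withDensity fun y => ENNReal.ofReal ((S k).1.1 y)
  have hμ : ∀ k A, MeasurableSet A → μ k A = ENNReal.ofReal (∫ y in A, (S k).1.1 y) := by
    intro k A hA
    rw [withDensity_apply _ hA, ofReal_integral_eq_lintegral_ofReal (hInt k).integrableOn]
    exact Eventually.of_forall (S k).2.2.2.1
  have hXanti : Antitone fun k => (S k).1.2 := antitone_nat_of_succ_le fun k => by
    change (S (k + 1)).1.2 ⊆ (S k).1.2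
    rw [hS]
    exact hn1 _ _
  refine (le_dimH_iInter_of_measures hs (C := ENNReal.ofReal C) ENNReal.ofReal_ne_top
    (fun k => (S k).1.2) hXanti (fun k => (S k).2.2.1) μ ?_ ?_).trans (dimH_mono ?_)
  · intro k x r hr hr1
    rw [hμ k _ Metric.isClosed_closedBall.measurableSet, ENNReal.ofReal_rpow_of_pos hr,
      ← ENNReal.ofReal_mul hC0]
    refine ENNReal.ofReal_le_ofReal ((hup k x r hr hr1).trans ?_)
    gcongr
    have : (0 : ℝ) ≤ (1 / 2) ^ k := by positivity
    linarith
  · intro k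
    have hm : MeasurableSet (S k).1.2 := (S k).2.2.1.measurableSet
    rw [hμ k _ hm]
    have h1 : ∫ y in unitCube n, (S k).1.1 y ≤ ∫ y in (S k).1.2, (S k).1.1 y := by
      rw [setIntegral_eq_integral_of_forall_compl_eq_zero (s := (S k).1.2) (S k).2.2.2.2]
      exact setIntegral_le_integral (hInt k) (Eventually.of_forall (S k).2.2.2.1)
    have h2 := hlow k
    have h4 : (0 : ℝ) ≤ (1 / 2) ^ (k + 1) := by positivity
    have h3 : (1 / 2 : ENNReal) = ENNReal.ofReal (1 / 2) := by
      rw [ENNReal.ofReal_div_of_pos two_pos]; simp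
    rw [h3]
    exact ENNReal.ofReal_le_ofReal (by linarith)
  · intro x hx
    rw [mem_limsup_iff_frequently_mem, frequently_atTop]
    intro N
    have h1 := mem_iInter.1 hx (N + 1)
    simp only [hS] at h1
    simpa using hn2 _ _ h1

/-- The tent function on `[-1, 1]`. -/
noncomputable def tent (x : ℝ) : ℝ := max 0 (1 - |x|)

theorem tent_continuous : Continuous tent := by
  unfold tent; fun_prop

theorem tent_nonneg (x : ℝ) : 0 ≤ tent x := le_max_left _ _

theorem tent_le_one (x : ℝ) : tent x ≤ 1 :=
  max_le zero_le_one (by linarith [abs_nonneg x])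

theorem tent_eq_zero {x : ℝ} (hx : 1 < |x|) : tent x = 0 :=
  max_eq_left (by linarith)

theorem integral_tent : ∫ x, tent x = 1 := by
  have h1 : ∫ x, tent x = 2 * ∫ x in Ioi (0 : ℝ), max 0 (1 - x) :=
    integral_comp_abs (f := fun x => max 0 (1 - x))
  have h2 : ∫ x in Ioi (0 : ℝ), max 0 (1 - x) = ∫ x in Ioc (0 : ℝ) 1, (1 - x) := by
    rw [setIntegral_eq_of_subset_of_forall_sdiff_eq_zero (s := Ioc (0 : ℝ) 1) measurableSet_Ioi
      Ioc_subset_Ioi_self (fun x hx => ?_)]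
    · refine setIntegral_congr_fun measurableSet_Ioc fun x hx => ?_
      exact max_eq_right (by linarith [hx.2])
    · have h : ¬ x ≤ 1 := fun h => hx.2 ⟨hx.1, h⟩
      exact max_eq_left (by linarith)
  rw [h1, h2, ← intervalIntegral.integral_of_le zero_le_one,
    intervalIntegral.integral_sub (by simp) (by simp), integral_id, intervalIntegral.integral_const]
  norm_num

/-- The normalised tent density on the box with centre `c` and half-widths `w`. -/
noncomputable def boxTent {n : ℕ} (c w : Fin n → ℝ) (x : Fin n → ℝ) : ℝ :=
  ∏ i, (w i)⁻¹ * tent ((x i - c i) / w i)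

theorem boxTent_continuous {n : ℕ} (c w : Fin n → ℝ) : Continuous (boxTent c w) := by
  unfold boxTent
  refine continuous_finsetProd _ fun i _ => continuous_const.mul (tent_continuous.comp ?_)
  fun_prop

theorem boxTent_nonneg {n : ℕ} (c : Fin n → ℝ) {w : Fin n → ℝ} (hw : ∀ i, 0 < w i)
    (x : Fin n → ℝ) : 0 ≤ boxTent c w x :=
  Finset.prod_nonneg fun i _ => mul_nonneg (inv_nonneg.2 (hw i).le) (tent_nonneg _)

theorem abs_sub_le_of_boxTent_ne_zero {n : ℕ} {c w : Fin n → ℝ} (hw : ∀ i, 0 < w i)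
    {x : Fin n → ℝ} (hx : boxTent c w x ≠ 0) (i : Fin n) : |x i - c i| ≤ w i := by
  by_contra! h
  refine hx (Finset.prod_eq_zero (Finset.mem_univ i) ?_)
  rw [tent_eq_zero, mul_zero]
  rwa [abs_div, abs_of_pos (hw i), one_lt_div (hw i)]

theorem boxTent_hasCompactSupport {n : ℕ} {c w : Fin n → ℝ} (hw : ∀ i, 0 < w i) :
    HasCompactSupport (boxTent c w) := by
  refine HasCompactSupport.intro (K := univ.pi fun i => Icc (c i - w i) (c i + w i))
    (isCompact_univ_pi fun i => isCompact_Icc) fun x hx => ?_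
  by_contra h
  refine hx fun i _ => ?_
  have := abs_le.1 (abs_sub_le_of_boxTent_ne_zero hw h i)
  exact ⟨by linarith [this.1], by linarith [this.2]⟩

theorem boxTent_integrable {n : ℕ} {c w : Fin n → ℝ} (hw : ∀ i, 0 < w i) :
    Integrable (boxTent c w) :=
  (boxTent_continuous c w).integrable_of_hasCompactSupport (boxTent_hasCompactSupport hw)

theorem integral_scaled_tent (c : ℝ) {w : ℝ} (hw : 0 < w) :
    ∫ x, w⁻¹ * tent ((x - c) / w) = 1 := by
  rw [integral_const_mul, integral_sub_right_eq_self (fun x => tent (x / w)) c,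
    Measure.integral_comp_div, integral_tent, abs_of_pos hw, smul_eq_mul, mul_one,
    inv_mul_cancel₀ hw.ne']

theorem integral_boxTent {n : ℕ} {c w : Fin n → ℝ} (hw : ∀ i, 0 < w i) :
    ∫ x, boxTent c w x = 1 := by
  unfold boxTent
  rw [integral_fintype_prod_volume_eq_prod (fun i x => (w i)⁻¹ * tent ((x - c i) / w i))]
  exact Finset.prod_eq_one fun i _ => integral_scaled_tent _ (hw i)

theorem setIntegral_boxTent_le {n : ℕ} {c w : Fin n → ℝ} (hw : ∀ i, 0 < w i) (x : Fin n → ℝ)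
    {r : ℝ} (hr : 0 < r) :
    ∫ y in Metric.closedBall x r, boxTent c w y ≤ ∏ i, min 1 (2 * r / w i) := by
  unfold boxTent
  rw [closedBall_pi x hr.le, volume_pi, Measure.restrict_pi_pi,
    integral_fintype_prod_eq_prod (fun i x => (w i)⁻¹ * tent ((x - c i) / w i))]
  refine Finset.prod_le_prod (fun i _ => ?_) fun i _ => le_min ?_ ?_
  · exact integral_nonneg fun y => mul_nonneg (inv_nonneg.2 (hw i).le) (tent_nonneg _)
  · rw [← integral_scaled_tent (c i) (hw i)]
    refine setIntegral_le_integral ?_ (Eventually.of_forall fun y =>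
      mul_nonneg (inv_nonneg.2 (hw i).le) (tent_nonneg _))
    refine Integrable.of_integral_ne_zero ?_
    rw [integral_scaled_tent (c i) (hw i)]
    exact one_ne_zero
  · have hc : Continuous fun y => (w i)⁻¹ * tent ((y - c i) / w i) :=
      continuous_const.mul (tent_continuous.comp (by fun_prop))
    have : ∫ y in Metric.closedBall (x i) r, (w i)⁻¹ * tent ((y - c i) / w i) ≤
        ∫ y in Metric.closedBall (x i) r, (w i)⁻¹ := by
      refine setIntegral_mono (hc.continuousOn.integrableOn_compact (isCompact_closedBall _ _)) ?_ ?_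
      · exact (integrableOn_const_iff).2 (Or.inr measure_closedBall_lt_top)
      · intro y
        exact mul_le_of_le_one_right (inv_nonneg.2 (hw i).le) (tent_le_one _)
    refine this.trans (le_of_eq ?_)
    simp [Measure.real, Real.volume_closedBall, hr.le]
    rfl

/-- The numerators of the rational points with denominator `q` in `[0,1)^n`. -/
def gridPts (n q : ℕ) : Finset (Fin n → ℕ) := Fintype.piFinset fun _ => Finset.range q

/-- The half-open cube of side `1/q` with lower corner `p/q`. -/
def gridCell {n : ℕ} (q : ℕ) (p : Fin n → ℕ) : Set (Fin n → ℝ) :=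
  univ.pi fun i => Ico ((p i : ℝ) / q) ((p i + 1) / q)

theorem gridCell_measurableSet {n : ℕ} (q : ℕ) (p : Fin n → ℕ) : MeasurableSet (gridCell q p) :=
  MeasurableSet.univ_pi fun _ => measurableSet_Ico

theorem volume_gridCell {n q : ℕ} (hq : 0 < q) (p : Fin n → ℕ) :
    volume.real (gridCell q p) = ((q : ℝ) ^ n)⁻¹ := by
  have h : ∀ i, ENNReal.ofReal (((p i : ℝ) + 1) / q - p i / q) = ENNReal.ofReal ((q : ℝ)⁻¹) := by
    intro i
    congr 1
    field_simp
    ring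
  rw [Measure.real, gridCell, volume_pi_pi]
  simp only [Real.volume_Ico, h, Finset.prod_const, Finset.card_univ, Fintype.card_fin]
  rw [← ENNReal.ofReal_pow (by positivity), ENNReal.toReal_ofReal (by positivity), inv_pow]

theorem mem_gridCell_iff_floor {n q : ℕ} (hq : 0 < q) (p : Fin n → ℕ) (x : Fin n → ℝ) :
    x ∈ gridCell q p ↔ ∀ i, ⌊(q : ℝ) * x i⌋ = (p i : ℤ) := by
  have hq' : (0 : ℝ) < q := by exact_mod_cast hq
  simp only [gridCell, mem_univ_pi, mem_Ico, Int.floor_eq_iff]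
  refine forall_congr' fun i => ?_
  rw [div_le_iff₀ hq', lt_div_iff₀ hq', mul_comm (x i)]
  simp

theorem gridCell_pairwiseDisjoint {n q : ℕ} (hq : 0 < q) (s : Set (Fin n → ℕ)) :
    s.Pairwise (Function.onFun Disjoint (gridCell q)) := by
  intro p _ p' _ hne
  refine Set.disjoint_left.2 fun x hx hx' => hne ?_
  rw [mem_gridCell_iff_floor hq] at hx hx'
  funext i
  exact_mod_cast (hx i).symm.trans (hx' i)

theorem iUnion_gridCell {n q : ℕ} (hq : 0 < q) :
    ⋃ p ∈ gridPts n q, gridCell q p = univ.pi fun _ => Ico (0 : ℝ) 1 := by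
  have hq' : (0 : ℝ) < q := by exact_mod_cast hq
  ext x
  simp only [mem_iUnion, exists_prop, mem_gridCell_iff_floor hq, mem_univ_pi, mem_Ico, gridPts,
    Fintype.mem_piFinset, Finset.mem_range]
  constructor
  · rintro ⟨p, hp, hx⟩ i
    have h1 := Int.floor_eq_iff.1 (hx i)
    have h2 : (p i : ℝ) + 1 ≤ q := by exact_mod_cast hp i
    simp only [Int.cast_natCast] at h1
    constructor
    · by_contra! h
      have : (q : ℝ) * x i < 0 := mul_neg_of_pos_of_neg hq' h
      linarith [h1.1, (Nat.cast_nonneg (p i) : (0 : ℝ) ≤ p i)]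
    · by_contra! h
      have : (q : ℝ) * 1 ≤ q * x i := by gcongr
      linarith [h1.2]
  · intro hx
    have h0 : ∀ i, 0 ≤ ⌊(q : ℝ) * x i⌋ := fun i =>
      Int.floor_nonneg.2 (mul_nonneg hq'.le (hx i).1)
    refine ⟨fun i => ⌊(q : ℝ) * x i⌋.toNat, fun i => ?_, fun i => ?_⟩
    · rw [Int.toNat_lt (h0 i), Int.floor_lt]
      have := mul_lt_mul_of_pos_left (hx i).2 hq'
      simpa using this
    · rw [Int.toNat_of_nonneg (h0 i)]

theorem setIntegral_unitCube_eq_sum {n q : ℕ} (hq : 0 < q) {g : (Fin n → ℝ) → ℝ}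
    (hg : Integrable g) :
    ∫ y in unitCube n, g y = ∑ p ∈ gridPts n q, ∫ y in gridCell q p, g y := by
  rw [← integral_biUnion_finset _ (fun p _ => gridCell_measurableSet q p)
    (gridCell_pairwiseDisjoint hq _) (fun p _ => hg.integrableOn), iUnion_gridCell hq]
  refine setIntegral_congr_set ?_
  rw [unitCube, Set.pi_univ_Icc]
  exact (Measure.univ_pi_Ico_ae_eq_Icc (f := fun _ : Fin n => (0 : ℝ)) (g := fun _ => 1)).symm

theorem volume_gridCell_ne_top {n q : ℕ} (hq : 0 < q) (p : Fin n → ℕ) :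
    volume (gridCell q p) ≠ ⊤ := by
  intro h
  have := volume_gridCell hq p
  rw [Measure.real, h, ENNReal.toReal_top] at this
  have hq' : (0 : ℝ) < q := by exact_mod_cast hq
  exact (by positivity : ((q : ℝ) ^ n)⁻¹ ≠ 0) this.symm

theorem dist_corner_le_of_mem_gridCell {n q : ℕ} {p : Fin n → ℕ} {y : Fin n → ℝ}
    (hy : y ∈ gridCell q p) : dist (fun i => (p i : ℝ) / q) y ≤ 1 / q := by
  refine (dist_pi_le_iff (by positivity)).2 fun i => ?_
  have : (p i : ℝ) / q ≤ y i ∧ y i < (p i + 1) / q := hy i (mem_univ i)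
  rw [add_div] at this
  rw [Real.dist_eq, abs_le]
  constructor <;> linarith [this.1, this.2, (by positivity : (0 : ℝ) ≤ 1 / q)]

theorem dist_corner_le_of_boxTent_ne_zero {n q : ℕ} {c w : Fin n → ℝ} (hw : ∀ i, 0 < w i)
    {p : Fin n → ℕ} (hl : ∀ i, (p i : ℝ) / q ≤ c i - w i)
    (hu : ∀ i, c i + w i ≤ (p i + 1) / q) {y : Fin n → ℝ} (hy : boxTent c w y ≠ 0) :
    dist y (fun i => (p i : ℝ) / q) ≤ 1 / q := by
  refine (dist_pi_le_iff (by positivity)).2 fun i => ?_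
  have h1 := abs_le.1 (abs_sub_le_of_boxTent_ne_zero hw hy i)
  have h2 := hl i
  have h3 := hu i
  rw [add_div] at h3
  rw [Real.dist_eq, abs_le]
  constructor <;> linarith [h1.1, h1.2, (by positivity : (0 : ℝ) ≤ 1 / q)]

/-- The mean of `g` against a box density inside a grid cell is comparable with its mean on the
cell. -/
theorem setIntegral_mul_boxTent_le {n q : ℕ} (hq : 0 < q) {g : (Fin n → ℝ) → ℝ}
    (hg : Continuous g) (hgi : Integrable g) (hg0 : ∀ x, 0 ≤ g x) {ω : ℝ}
    (hω : ∀ x y, dist x y ≤ 1 / q → |g x - g y| ≤ ω)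
    {c w : Fin n → ℝ} (hw : ∀ i, 0 < w i) {p : Fin n → ℕ} (hl : ∀ i, (p i : ℝ) / q ≤ c i - w i)
    (hu : ∀ i, c i + w i ≤ (p i + 1) / q) (B : Set (Fin n → ℝ)) :
    ((q : ℝ) ^ n)⁻¹ * ∫ y in B, g y * boxTent c w y ≤ ∫ y in gridCell q p, (g y + 2 * ω) := by
  have hq' : (0 : ℝ) < q := by exact_mod_cast hq
  set z : Fin n → ℝ := fun i => (p i : ℝ) / q
  have hω0 : 0 ≤ ω := by simpa using hω 0 0 (by simp)
  have hpt : ∀ y, g y * boxTent c w y ≤ (g z + ω) * boxTent c w y := by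
    intro y
    by_cases hy : boxTent c w y = 0
    · simp [hy]
    · refine mul_le_mul_of_nonneg_right ?_ (boxTent_nonneg c hw y)
      linarith [(abs_le.1 (hω y z (dist_corner_le_of_boxTent_ne_zero hw hl hu hy))).2]
  have hbi := boxTent_integrable (c := c) hw
  have hgb : Integrable fun y => g y * boxTent c w y :=
    (hg.mul (boxTent_continuous c w)).integrable_of_hasCompactSupport
      (boxTent_hasCompactSupport hw).mul_left
  have h1 : ∫ y in B, g y * boxTent c w y ≤ g z + ω := by
    calc ∫ y in B, g y * boxTent c w y ≤ ∫ y in B, (g z + ω) * boxTent c w y :=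
          setIntegral_mono hgb.integrableOn (hbi.const_mul _).integrableOn hpt
      _ = (g z + ω) * ∫ y in B, boxTent c w y := integral_const_mul _ _
      _ ≤ (g z + ω) * ∫ y, boxTent c w y := by
          refine mul_le_mul_of_nonneg_left ?_ (by linarith [hg0 z])
          exact setIntegral_le_integral hbi (Eventually.of_forall (boxTent_nonneg c hw))
      _ = g z + ω := by rw [integral_boxTent hw, mul_one]
  have h2 : ((q : ℝ) ^ n)⁻¹ * (g z + ω) = ∫ y in gridCell q p, (g z + ω) := by
    rw [setIntegral_const, volume_gridCell hq, smul_eq_mul]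
  calc _ ≤ ((q : ℝ) ^ n)⁻¹ * (g z + ω) := by gcongr
    _ = ∫ y in gridCell q p, (g z + ω) := h2
    _ ≤ _ := by
      refine setIntegral_mono_on (integrableOn_const (volume_gridCell_ne_top hq p))
        (hgi.integrableOn.add (integrableOn_const (volume_gridCell_ne_top hq p)))
        (gridCell_measurableSet q p) ?_
      intro y hy
      linarith [(abs_le.1 (hω z y (dist_corner_le_of_mem_gridCell hy))).2]

theorem mem_unitCube_of_boxTent_ne_zero {n q : ℕ} (hq : 0 < q) {c w : Fin n → ℝ}
    (hw : ∀ i, 0 < w i) {p : Fin n → ℕ} (hp : p ∈ gridPts n q)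
    (hl : ∀ i, (p i : ℝ) / q ≤ c i - w i) (hu : ∀ i, c i + w i ≤ (p i + 1) / q)
    {y : Fin n → ℝ} (hy : boxTent c w y ≠ 0) : y ∈ unitCube n := by
  intro i _
  have hq' : (0 : ℝ) < q := by exact_mod_cast hq
  have h1 := abs_le.1 (abs_sub_le_of_boxTent_ne_zero hw hy i)
  have h2 : (p i : ℝ) + 1 ≤ q := by
    exact_mod_cast Finset.mem_range.1 (Fintype.mem_piFinset.1 hp i)
  have h3 : ((p i : ℝ) + 1) / q ≤ 1 := (div_le_one hq').2 h2
  have h4 : (0 : ℝ) ≤ (p i : ℝ) / q := by positivity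
  exact ⟨by linarith [hl i], by linarith [hu i]⟩

theorem le_setIntegral_mul_boxTent {n q : ℕ} (hq : 0 < q) {g : (Fin n → ℝ) → ℝ}
    (hg : Continuous g) (hgi : Integrable g) {ω : ℝ}
    (hω : ∀ x y, dist x y ≤ 1 / q → |g x - g y| ≤ ω)
    {c w : Fin n → ℝ} (hw : ∀ i, 0 < w i) {p : Fin n → ℕ} (hp : p ∈ gridPts n q)
    (hl : ∀ i, (p i : ℝ) / q ≤ c i - w i) (hu : ∀ i, c i + w i ≤ (p i + 1) / q) :
    ∫ y in gridCell q p, (g y - 2 * ω) ≤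
      ((q : ℝ) ^ n)⁻¹ * ∫ y in unitCube n, g y * boxTent c w y := by
  have hq' : (0 : ℝ) < q := by exact_mod_cast hq
  set z : Fin n → ℝ := fun i => (p i : ℝ) / q
  have hpt : ∀ y, (g z - ω) * boxTent c w y ≤ g y * boxTent c w y := by
    intro y
    by_cases hy : boxTent c w y = 0
    · simp [hy]
    · refine mul_le_mul_of_nonneg_right ?_ (boxTent_nonneg c hw y)
      linarith [(abs_le.1 (hω y z (dist_corner_le_of_boxTent_ne_zero hw hl hu hy))).1]
  have hbi := boxTent_integrable (c := c) hw
  have hgb : Integrable fun y => g y * boxTent c w y :=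
    (hg.mul (boxTent_continuous c w)).integrable_of_hasCompactSupport
      (boxTent_hasCompactSupport hw).mul_left
  have h1 : g z - ω ≤ ∫ y in unitCube n, g y * boxTent c w y := by
    calc g z - ω = (g z - ω) * ∫ y, boxTent c w y := by rw [integral_boxTent hw, mul_one]
      _ = ∫ y, (g z - ω) * boxTent c w y := (integral_const_mul _ _).symm
      _ ≤ ∫ y, g y * boxTent c w y := integral_mono (hbi.const_mul _) hgb hpt
      _ = ∫ y in unitCube n, g y * boxTent c w y := by
          refine (setIntegral_eq_integral_of_forall_compl_eq_zero fun y hy => ?_).symm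
          by_contra h
          exact hy (mem_unitCube_of_boxTent_ne_zero hq hw hp hl hu (right_ne_zero_of_mul h))
  calc _ ≤ ∫ y in gridCell q p, (g z - ω) := by
        refine setIntegral_mono_on
          (hgi.integrableOn.sub (integrableOn_const (volume_gridCell_ne_top hq p)))
          (integrableOn_const (volume_gridCell_ne_top hq p)) (gridCell_measurableSet q p) ?_
        intro y hy
        linarith [(abs_le.1 (hω z y (dist_corner_le_of_mem_gridCell hy))).1]
    _ = ((q : ℝ) ^ n)⁻¹ * (g z - ω) := by
        rw [setIntegral_const, volume_gridCell hq, smul_eq_mul]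
    _ ≤ _ := by gcongr

theorem sum_setIntegral_mul_boxTent_le {n q : ℕ} (hq : 0 < q) {g : (Fin n → ℝ) → ℝ}
    (hg : Continuous g) (hgi : Integrable g) (hg0 : ∀ x, 0 ≤ g x) {ω : ℝ}
    (hω : ∀ x y, dist x y ≤ 1 / q → |g x - g y| ≤ ω)
    {c : (Fin n → ℕ) → Fin n → ℝ} {w : Fin n → ℝ} (hw : ∀ i, 0 < w i)
    (hl : ∀ p i, (p i : ℝ) / q ≤ c p i - w i) (hu : ∀ p i, c p i + w i ≤ (p i + 1) / q)
    (S : Finset (Fin n → ℕ)) (x : Fin n → ℝ) (r : ℝ) :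
    ∑ p ∈ S, ((q : ℝ) ^ n)⁻¹ * ∫ y in Metric.closedBall x r, g y * boxTent (c p) w y ≤
      ∫ y in Metric.closedBall x (r + 2 / q), (g y + 2 * ω) := by
  classical
  have hω0 : 0 ≤ ω := by simpa using hω 0 0 (by simp)
  set F : (Fin n → ℕ) → ℝ := fun p =>
    ((q : ℝ) ^ n)⁻¹ * ∫ y in Metric.closedBall x r, g y * boxTent (c p) w y with hF
  have hball : IntegrableOn (fun y => g y + 2 * ω) (Metric.closedBall x (r + 2 / q)) :=
    (hg.add continuous_const).continuousOn.integrableOn_compact (isCompact_closedBall _ _)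
  have hsub : ⋃ p ∈ S.filter (fun p => F p ≠ 0), gridCell q p ⊆
      Metric.closedBall x (r + 2 / q) := by
    refine iUnion₂_subset fun p hp z hz => ?_
    have hne := (Finset.mem_filter.1 hp).2
    obtain ⟨y, hy, hyne⟩ : ∃ y ∈ Metric.closedBall x r, boxTent (c p) w y ≠ 0 := by
      by_contra! h
      refine hne ?_
      rw [hF]
      simp only
      rw [setIntegral_eq_zero_of_forall_eq_zero fun y hy => by rw [h y hy, mul_zero], mul_zero]
    have h1 := dist_corner_le_of_boxTent_ne_zero hw (hl p) (hu p) hyne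
    have h2 := dist_corner_le_of_mem_gridCell hz
    have h3 : dist y x ≤ r := hy
    rw [Metric.mem_closedBall]
    have h4 := dist_triangle z y x
    have h5 := dist_triangle z (fun i => (p i : ℝ) / q) y
    rw [dist_comm] at h1 h2
    have h6 : (2 : ℝ) / q = 1 / q + 1 / q := by ring
    linarith
  calc ∑ p ∈ S, F p = ∑ p ∈ S.filter (fun p => F p ≠ 0), F p := (Finset.sum_filter_ne_zero S).symm
    _ ≤ ∑ p ∈ S.filter (fun p => F p ≠ 0), ∫ y in gridCell q p, (g y + 2 * ω) :=
        Finset.sum_le_sum fun p _ => setIntegral_mul_boxTent_le hq hg hgi hg0 hω hw (hl p) (hu p) _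
    _ = ∫ y in ⋃ p ∈ S.filter (fun p => F p ≠ 0), gridCell q p, (g y + 2 * ω) := by
        refine (integral_biUnion_finset _ (fun p _ => gridCell_measurableSet q p)
          (gridCell_pairwiseDisjoint hq _) fun p hp => ?_).symm
        exact hball.mono_set ((subset_biUnion_of_mem (u := gridCell q) hp).trans hsub)
    _ ≤ _ := by
        refine setIntegral_mono_set hball (Eventually.of_forall fun y => ?_) hsub.eventuallyLE
        have := hg0 y
        positivity

theorem volume_real_closedBall {n : ℕ} (x : Fin n → ℝ) {r : ℝ} (hr : 0 ≤ r) :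
    volume.real (Metric.closedBall x r) = (2 * r) ^ n := by
  rw [Measure.real, Real.volume_pi_closedBall x hr, ENNReal.toReal_ofReal (by positivity),
    Fintype.card_fin]

theorem setIntegral_closedBall_add_le {n : ℕ} {g : (Fin n → ℝ) → ℝ} (hg : Continuous g)
    {M : ℝ} (hM : ∀ x, g x ≤ M) (ω : ℝ) (x : Fin n → ℝ) {r η : ℝ} (hr : 0 ≤ r) (hη : 0 ≤ η) :
    ∫ y in Metric.closedBall x (r + η), (g y + 2 * ω) ≤
      (∫ y in Metric.closedBall x r, g y) + M * ((2 * (r + η)) ^ n - (2 * r) ^ n) +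
        2 * ω * (2 * (r + η)) ^ n := by
  have hi : ∀ ρ, IntegrableOn g (Metric.closedBall x ρ) := fun ρ =>
    hg.continuousOn.integrableOn_compact (isCompact_closedBall _ _)
  have hfin : ∀ ρ, volume (Metric.closedBall x ρ) ≠ ⊤ := fun ρ =>
    (isCompact_closedBall x ρ).measure_lt_top.ne
  have hsub : Metric.closedBall x r ⊆ Metric.closedBall x (r + η) :=
    Metric.closedBall_subset_closedBall (by linarith)
  have h1 : ∫ y in Metric.closedBall x (r + η), (g y + 2 * ω) =
      (∫ y in Metric.closedBall x (r + η), g y) + 2 * ω * (2 * (r + η)) ^ n := by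
    rw [integral_add (hi _) (integrableOn_const (hfin _)), setIntegral_const,
      volume_real_closedBall x (by positivity), smul_eq_mul, mul_comm (2 * ω)]
  have h2 : (∫ y in Metric.closedBall x (r + η), g y) =
      (∫ y in Metric.closedBall x r, g y) +
        ∫ y in Metric.closedBall x (r + η) \ Metric.closedBall x r, g y := by
    rw [← setIntegral_union disjoint_sdiff_right
      (Metric.isClosed_closedBall.measurableSet.diff Metric.isClosed_closedBall.measurableSet)
      (hi _) ((hi _).mono_set sdiff_subset), union_sdiff_cancel hsub]
  have h3 : ∫ y in Metric.closedBall x (r + η) \ Metric.closedBall x r, g y ≤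
      M * ((2 * (r + η)) ^ n - (2 * r) ^ n) := by
    calc _ ≤ ∫ y in Metric.closedBall x (r + η) \ Metric.closedBall x r, M := by
          refine setIntegral_mono ((hi _).mono_set sdiff_subset)
            (integrableOn_const (ne_top_of_le_ne_top (hfin (r + η)) (measure_mono sdiff_subset)))
            hM
      _ = _ := by
          rw [setIntegral_const, measureReal_sdiff hsub Metric.isClosed_closedBall.measurableSet (hfin _),
            volume_real_closedBall x hr, volume_real_closedBall x (by positivity), smul_eq_mul,
            mul_comm]
  linarith

theorem pow_sub_pow_mul_le {a b : ℝ} (hb : 0 ≤ b) (hab : b ≤ a) (n : ℕ) :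
    (a ^ n - b ^ n) * a ≤ n * (a - b) * a ^ n := by
  have ha := hb.trans hab
  induction n with
  | zero => simp
  | succ n ih =>
    have h1 : (a - b) * b ^ n ≤ (a - b) * a ^ n :=
      mul_le_mul_of_nonneg_left (pow_le_pow_left₀ hb hab n) (by linarith)
    have h2 := mul_le_mul_of_nonneg_left ih ha
    have h3 := mul_le_mul_of_nonneg_right h1 ha
    push_cast
    calc (a ^ (n + 1) - b ^ (n + 1)) * a = a * ((a ^ n - b ^ n) * a) + (a - b) * b ^ n * a := by
          ring
      _ ≤ a * (n * (a - b) * a ^ n) + (a - b) * a ^ n * a := by linarith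
      _ = _ := by ring

/-- The volume of a thin annulus is small compared with `r ^ s` for `s < n`. -/
theorem annulus_le {n : ℕ} {s θ y r : ℝ} (hθ1 : θ ≤ 1) (hθs : θ ≤ n - s)
    (hy : 0 < y) (hyr : y ≤ r) (hr : r ≤ 1) :
    (2 * (r + 2 * y)) ^ n - (2 * r) ^ n ≤ 2 * n * 6 ^ n * y ^ θ * r ^ s := by
  have hr0 : 0 < r := hy.trans_le hyr
  have h1 := pow_sub_pow_mul_le (a := 2 * (r + 2 * y)) (b := 2 * r) (by positivity)
    (by linarith) n
  have h2 : (2 * (r + 2 * y)) ^ n ≤ 6 ^ n * r ^ n := by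
    rw [← mul_pow]
    exact pow_le_pow_left₀ (by positivity) (by linarith) n
  have h3 : ((2 * (r + 2 * y)) ^ n - (2 * r) ^ n) * (2 * r) ≤
      n * (4 * y) * (6 ^ n * r ^ n) := by
    calc _ ≤ ((2 * (r + 2 * y)) ^ n - (2 * r) ^ n) * (2 * (r + 2 * y)) := by
          refine mul_le_mul_of_nonneg_left (by linarith) ?_
          have := pow_le_pow_left₀ (by positivity : 0 ≤ 2 * r)
            (by linarith : 2 * r ≤ 2 * (r + 2 * y)) n
          linarith
      _ ≤ _ := h1
      _ = n * (4 * y) * (2 * (r + 2 * y)) ^ n := by ring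
      _ ≤ _ := by gcongr
  have h4 : y * r ^ n ≤ y ^ θ * r ^ s * r := by
    have e1 : y = y ^ θ * y ^ (1 - θ) := by
      rw [← Real.rpow_add hy]
      simp
    have e2 : y ^ (1 - θ) ≤ r ^ (1 - θ) := Real.rpow_le_rpow hy.le hyr (by linarith)
    have e3 : r ^ (1 - θ) * r ^ n ≤ r ^ s * r := by
      rw [← Real.rpow_natCast r n, ← Real.rpow_add hr0, ← Real.rpow_add_one hr0.ne']
      exact Real.rpow_le_rpow_of_exponent_ge hr0 hr (by linarith)
    have hyθ : 0 ≤ y ^ θ := by positivity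
    calc y * r ^ n = y ^ θ * (y ^ (1 - θ) * r ^ n) := by rw [← mul_assoc, ← e1]
      _ ≤ y ^ θ * (r ^ (1 - θ) * r ^ n) := by gcongr
      _ ≤ y ^ θ * (r ^ s * r) := by gcongr
      _ = _ := by ring
  have h5 : ((2 * (r + 2 * y)) ^ n - (2 * r) ^ n) * (2 * r) ≤
      (2 * n * 6 ^ n * y ^ θ * r ^ s) * (2 * r) := by
    calc _ ≤ n * (4 * y) * (6 ^ n * r ^ n) := h3
      _ = 4 * n * 6 ^ n * (y * r ^ n) := by ring
      _ ≤ 4 * n * 6 ^ n * (y ^ θ * r ^ s * r) := by gcongr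
      _ = _ := by ring
  exact le_of_mul_le_mul_right h5 (by positivity)

theorem sum_setIntegral_mul_boxTent_le_add {n q : ℕ} (hq : 0 < q) {g : (Fin n → ℝ) → ℝ}
    (hg : Continuous g) (hgi : Integrable g) (hg0 : ∀ x, 0 ≤ g x) {M : ℝ} (hM : ∀ x, g x ≤ M)
    {ω : ℝ} (hω : ∀ x y, dist x y ≤ 1 / q → |g x - g y| ≤ ω)
    {c : (Fin n → ℕ) → Fin n → ℝ} {w : Fin n → ℝ} (hw : ∀ i, 0 < w i)
    (hl : ∀ p i, (p i : ℝ) / q ≤ c p i - w i) (hu : ∀ p i, c p i + w i ≤ (p i + 1) / q)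
    (S : Finset (Fin n → ℕ)) {s θ : ℝ} (hθ0 : 0 < θ) (hθ1 : θ ≤ 1) (hθs : θ ≤ n - s)
    (x : Fin n → ℝ) {r : ℝ} (hqr : 1 / q ≤ r) (hr : r ≤ 1) :
    ∑ p ∈ S, ((q : ℝ) ^ n)⁻¹ * ∫ y in Metric.closedBall x r, g y * boxTent (c p) w y ≤
      (∫ y in Metric.closedBall x r, g y) +
        (M * (2 * n * 6 ^ n * (1 / q) ^ θ) + 2 * ω * 6 ^ n) * r ^ s := by
  have hq' : (0 : ℝ) < q := by exact_mod_cast hq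
  have hy : (0 : ℝ) < 1 / q := by positivity
  have hr0 : 0 < r := hy.trans_le hqr
  have hω0 : 0 ≤ ω := by simpa using hω 0 0 (by simp)
  have hM0 : 0 ≤ M := (hg0 0).trans (hM 0)
  have h2 : (2 : ℝ) / q = 2 * (1 / q) := by ring
  have h3 := sum_setIntegral_mul_boxTent_le hq hg hgi hg0 hω hw hl hu S x r
  have h4 := setIntegral_closedBall_add_le hg hM ω x hr0.le (by positivity : 0 ≤ (2 : ℝ) / q)
  have h5 := annulus_le hθ1 hθs hy hqr hr
  rw [← h2] at h5
  have h6 := mul_le_mul_of_nonneg_left h5 hM0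
  have h7 : (2 * (r + 2 / q)) ^ n ≤ 6 ^ n * r ^ s := by
    calc (2 * (r + 2 / q)) ^ n ≤ (6 * r) ^ n := by
          refine pow_le_pow_left₀ (by positivity) ?_ n
          rw [h2]
          linarith
      _ = 6 ^ n * r ^ (n : ℝ) := by rw [mul_pow, Real.rpow_natCast]
      _ ≤ _ := by
          gcongr ?_ * ?_
          exact Real.rpow_le_rpow_of_exponent_ge hr0 hr (by linarith)
  have h8 := mul_le_mul_of_nonneg_left h7 (by positivity : 0 ≤ 2 * ω)
  linarith

theorem le_sum_setIntegral_mul_boxTent {n q : ℕ} (hq : 0 < q) {g : (Fin n → ℝ) → ℝ}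
    (hg : Continuous g) (hgi : Integrable g) {ω : ℝ}
    (hω : ∀ x y, dist x y ≤ 1 / q → |g x - g y| ≤ ω)
    {c : (Fin n → ℕ) → Fin n → ℝ} {w : Fin n → ℝ} (hw : ∀ i, 0 < w i)
    (hl : ∀ p i, (p i : ℝ) / q ≤ c p i - w i) (hu : ∀ p i, c p i + w i ≤ (p i + 1) / q) :
    (∫ y in unitCube n, g y) - 2 * ω ≤
      ∑ p ∈ gridPts n q, ((q : ℝ) ^ n)⁻¹ * ∫ y in unitCube n, g y * boxTent (c p) w y := by
  have hq' : (0 : ℝ) < q := by exact_mod_cast hq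
  calc (∫ y in unitCube n, g y) - 2 * ω =
        ∑ p ∈ gridPts n q, ∫ y in gridCell q p, (g y - 2 * ω) := by
        have : ∀ p ∈ gridPts n q, ∫ y in gridCell q p, (g y - 2 * ω) =
            (∫ y in gridCell q p, g y) - ((q : ℝ) ^ n)⁻¹ * (2 * ω) := by
          intro p _
          rw [integral_sub hgi.integrableOn (integrableOn_const (volume_gridCell_ne_top hq p)),
            setIntegral_const, volume_gridCell hq, smul_eq_mul]
        rw [Finset.sum_congr rfl this, Finset.sum_sub_distrib, ← setIntegral_unitCube_eq_sum hq hgi,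
          Finset.sum_const, gridPts, Fintype.card_piFinset]
        simp only [Finset.card_range, Finset.prod_const, Finset.card_univ, Fintype.card_fin,
          nsmul_eq_mul, Nat.cast_pow]
        rw [mul_inv_cancel_left₀ (by positivity)]
    _ ≤ _ := Finset.sum_le_sum fun p hp =>
        le_setIntegral_mul_boxTent hq hg hgi hω hw hp (hl p) (hu p)

theorem exists_sum_min_eq {n : ℕ} {t : Fin n → ℝ} (ht : ∀ i, 0 < t i) {σ : ℝ} (hσ : 0 < σ)
    (hσt : σ ≤ ∑ i, t i) : ∃ c, 0 < c ∧ ∑ i, min (t i) c = σ := by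
  have hT : 0 ≤ ∑ i, t i := Finset.sum_nonneg fun i _ => (ht i).le
  have hcont : ContinuousOn (fun c => ∑ i, min (t i) c) (Icc 0 (∑ i, t i)) := by
    refine Continuous.continuousOn ?_
    fun_prop
  have h0 : ∑ i, min (t i) 0 = 0 := Finset.sum_eq_zero fun i _ => min_eq_right (ht i).le
  have h1 : ∑ i, min (t i) (∑ k, t k) = ∑ i, t i := Finset.sum_congr rfl fun i _ =>
    min_eq_left (Finset.single_le_sum (fun k _ => (ht k).le) (Finset.mem_univ i))
  obtain ⟨c, hc, hcσ⟩ := intermediate_value_Icc hT hcont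
    (show σ ∈ Icc _ _ by simp only [h0, h1]; exact ⟨hσ.le, hσt⟩)
  refine ⟨c, lt_of_le_of_ne hc.1 fun h => ?_, hcσ⟩
  subst h
  simp only [h0] at hcσ
  exact hσ.ne hcσ

theorem le_sum_max_of_breakpoints {n : ℕ} {t : Fin n → ℝ} {s A c : ℝ} (hsn : s < n)
    (hc : s * (1 + c) ≤ A + ∑ i, max 0 (c - t i))
    (hk : ∀ k, s * (1 + t k) ≤ A + ∑ i, max 0 (t k - t i)) {v : ℝ} (hv : c ≤ v) :
    s * (1 + v) ≤ A + ∑ i, max 0 (v - t i) := by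
  classical
  set L := Finset.univ.filter fun i => t i ≤ v with hL
  have hS : ∀ b, (∀ i, t i ≤ v → t i ≤ b) → (∀ i, v < t i → b ≤ t i) →
      ∑ i, max 0 (b - t i) = ∑ i ∈ L, (b - t i) := by
    intro b h1 h2
    rw [hL, Finset.sum_filter]
    refine Finset.sum_congr rfl fun i _ => ?_
    split_ifs with h
    · exact max_eq_right (by linarith [h1 i h])
    · exact max_eq_left (by linarith [h2 i (not_le.1 h)])
  have hdiff : ∀ b, ∑ i ∈ L, (v - t i) = ∑ i ∈ L, (b - t i) + L.card * (v - b) := by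
    intro b
    rw [← nsmul_eq_mul, ← Finset.sum_const, ← Finset.sum_add_distrib]
    exact Finset.sum_congr rfl fun i _ => by ring
  have hSv := hS v (fun i h => h) fun i h => h.le
  rcases le_or_gt s L.card with hm | hm
  · obtain ⟨a, hav, haL, hca, ha⟩ : ∃ a ≤ v, (∀ i, t i ≤ v → t i ≤ a) ∧ c ≤ a ∧
        s * (1 + a) ≤ A + ∑ i, max 0 (a - t i) := by
      obtain ⟨a, ha, hmax⟩ := Finset.exists_max_image (insert c (L.image t)) id
        (Finset.insert_nonempty _ _)
      simp only [id] at hmax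
      have hcL : ∀ i, t i ≤ v → t i ≤ a := fun i hi =>
        hmax _ (Finset.mem_insert_of_mem (Finset.mem_image_of_mem t (by simp [hL, hi])))
      have hca := hmax _ (Finset.mem_insert_self c (L.image t))
      rcases Finset.mem_insert.1 ha with rfl | ha
      · exact ⟨a, hv, hcL, hca, hc⟩
      · obtain ⟨k, hkL, rfl⟩ := Finset.mem_image.1 ha
        exact ⟨t k, (Finset.mem_filter.1 hkL).2, hcL, hca, hk k⟩
    rw [hSv, hdiff a]
    rw [hS a haL fun i h => hav.trans h.le] at ha
    have := mul_le_mul_of_nonneg_right hm (by linarith : 0 ≤ v - a)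
    linarith
  · have hne : (Lᶜ).Nonempty := by
      rw [← Finset.card_pos, Finset.card_compl, Fintype.card_fin]
      have : (L.card : ℝ) < n := hm.trans hsn
      have : L.card < n := by exact_mod_cast this
      omega
    obtain ⟨k, hkL, hmin⟩ := Finset.exists_min_image Lᶜ t hne
    have hmem : ∀ i, i ∈ Lᶜ ↔ v < t i := by simp [hL]
    have hkv := (hmem k).1 hkL
    have hb := hk k
    rw [hS (t k) (fun i h => h.trans hkv.le) fun i h => hmin i ((hmem i).2 h)] at hb
    rw [hSv, hdiff (t k)]
    have := mul_le_mul_of_nonneg_right hm.le (by linarith : 0 ≤ t k - v)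
    linarith

theorem mul_le_sum_min_add_max {n : ℕ} {t : Fin n → ℝ} {s σ c : ℝ} (hsn : s < n)
    (hc : 0 ≤ c) (hσ : ∑ i, min (t i) c = σ)
    (hk : ∀ k, s * (1 + t k) ≤ n + σ + ∑ i, max 0 (t k - t i)) {u : ℝ} (hu : 0 ≤ u) :
    s * u ≤ ∑ i, (min (1 + min (t i) c) u + max 0 (u - 1 - t i)) := by
  rcases le_or_gt u (1 + c) with h | h
  · calc s * u ≤ n * u := by gcongr
      _ = ∑ i : Fin n, u := by simp
      _ ≤ _ := by
        refine Finset.sum_le_sum fun i _ => ?_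
        rcases le_or_gt u (1 + t i) with h1 | h1
        · rw [min_eq_right]
          · linarith [le_max_left 0 (u - 1 - t i)]
          · rcases min_choice (t i) c with h2 | h2 <;> rw [h2] <;> assumption
        · have := le_max_right 0 (u - 1 - t i)
          rw [min_eq_left (by linarith : t i ≤ c), min_eq_left h1.le]
          linarith
  · have hcb : s * (1 + c) ≤ n + σ + ∑ i, max 0 (c - t i) := by
      have h1 : ∑ i, min (t i) c + ∑ i, max 0 (c - t i) = n * c := by
        rw [← Finset.sum_add_distrib]
        have : ∀ i, min (t i) c + max 0 (c - t i) = c := by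
          intro i
          rcases le_total (t i) c with h2 | h2
          · rw [min_eq_left h2, max_eq_right (by linarith)]
            ring
          · rw [min_eq_right h2, max_eq_left (by linarith)]
            ring
        simp [this]
      have h2 : s * (1 + c) ≤ n * (1 + c) := by gcongr
      linarith
    have h1 := le_sum_max_of_breakpoints hsn hcb hk (v := u - 1) (by linarith)
    have h2 : ∀ i, min (1 + min (t i) c) u = 1 + min (t i) c := fun i =>
      min_eq_left (by linarith [min_le_right (t i) c])
    simp only [h2, Finset.sum_add_distrib, hσ]
    simp only [Finset.sum_const, Finset.card_univ, Fintype.card_fin, nsmul_eq_mul, mul_one]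
    calc s * u = s * (1 + (u - 1)) := by ring
      _ ≤ _ := h1

theorem exists_many_primes {β : ℝ} (hβ0 : 0 ≤ β) (hβ1 : β < 1) (N : ℕ) :
    ∃ Q : ℕ, N ≤ Q ∧ 0 < Q ∧ ∃ 𝒬 : Finset ℕ, (∀ q ∈ 𝒬, q.Prime ∧ Q ≤ q ∧ q ≤ 2 * Q) ∧
      (Q : ℝ) ^ β ≤ 𝒬.card ∧ (𝒬.card : ℝ) ≤ 2 * (Q : ℝ) ^ β := by
  obtain ⟨k, hNk, hk⟩ : ∃ k, N ≤ k ∧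
      ((2 ^ k : ℕ) : ℝ) ^ β ≤ ((Finset.Ico (2 ^ k) (2 ^ (k + 1))).filter Nat.Prime).card := by
    by_contra! h
    refine not_summable_one_div_on_primes ?_
    set f : ℕ → ℝ := indicator {p : ℕ | p.Prime} fun n : ℕ => (1 : ℝ) / n with hf
    have hf0 : ∀ i, 0 ≤ f i := fun i => indicator_nonneg (fun i _ => by positivity) i
    set ρ : ℝ := 2 ^ (β - 1) with hρ
    have hρ0 : 0 ≤ ρ := by positivity
    have hρ1 : ρ < 1 := Real.rpow_lt_one_of_one_lt_of_neg one_lt_two (by linarith)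
    have hblock : ∀ k, N ≤ k → ∑ i ∈ Finset.Ico (2 ^ k) (2 ^ (k + 1)), f i ≤ ρ ^ k := by
      intro k hk
      calc ∑ i ∈ Finset.Ico (2 ^ k) (2 ^ (k + 1)), f i
          = ∑ i ∈ (Finset.Ico (2 ^ k) (2 ^ (k + 1))).filter Nat.Prime, (1 : ℝ) / i := by
            rw [Finset.sum_filter]
            refine Finset.sum_congr rfl fun i _ => ?_
            simp [hf, indicator_apply]
        _ ≤ ∑ i ∈ (Finset.Ico (2 ^ k) (2 ^ (k + 1))).filter Nat.Prime, (1 : ℝ) / 2 ^ k := by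
            refine Finset.sum_le_sum fun i hi => ?_
            have : ((2 ^ k : ℕ) : ℝ) ≤ i := by
              exact_mod_cast (Finset.mem_Ico.1 (Finset.mem_filter.1 hi).1).1
            push_cast at this
            gcongr
        _ = ((Finset.Ico (2 ^ k) (2 ^ (k + 1))).filter Nat.Prime).card / 2 ^ k := by
            rw [Finset.sum_const, nsmul_eq_mul, mul_one_div]
        _ ≤ ((2 ^ k : ℕ) : ℝ) ^ β / 2 ^ k := by
            gcongr
            exact (h k hk).le
        _ = ρ ^ k := by
            push_cast
            rw [hρ, ← Real.rpow_natCast 2 k, ← Real.rpow_natCast _ k, ← Real.rpow_mul two_pos.le,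
              ← Real.rpow_mul two_pos.le, ← Real.rpow_sub two_pos]
            congr 1
            ring
    have hpart : ∀ m, ∑ i ∈ Finset.range (2 ^ (N + m)), f i ≤
        ∑ i ∈ Finset.range (2 ^ N), f i + ∑ k ∈ Finset.range m, ρ ^ k := by
      intro m
      induction m with
      | zero => simp
      | succ m ih =>
        rw [← add_assoc, ← Finset.sum_range_add_sum_Ico f
          (Nat.pow_le_pow_right two_pos (Nat.le_succ (N + m))), Finset.sum_range_succ _ m]
        have h1 := hblock (N + m) (by omega)
        have h2 : ρ ^ (N + m) ≤ ρ ^ m := pow_le_pow_of_le_one hρ0 hρ1.le (by omega)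
        simp only [Nat.succ_eq_add_one]
        linarith
    refine summable_of_sum_range_le (c := ∑ i ∈ Finset.range (2 ^ N), f i + (1 - ρ)⁻¹) hf0
      fun m => ?_
    have h1 : m ≤ 2 ^ (N + m) := (Nat.le_add_left m N).trans Nat.lt_two_pow_self.le
    calc _ ≤ ∑ i ∈ Finset.range (2 ^ (N + m)), f i :=
          Finset.sum_le_sum_of_subset_of_nonneg (Finset.range_mono h1) fun i _ _ => hf0 i
      _ ≤ _ := hpart m
      _ ≤ _ := by
          gcongr
          rw [← tsum_geometric_of_lt_one hρ0 hρ1]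
          exact (summable_geometric_of_lt_one hρ0 hρ1).sum_le_tsum _ fun i _ => by positivity
  have hQ1 : (1 : ℝ) ≤ ((2 ^ k : ℕ) : ℝ) := by exact_mod_cast Nat.one_le_two_pow
  have h1 : 1 ≤ ((2 ^ k : ℕ) : ℝ) ^ β := Real.one_le_rpow hQ1 hβ0
  obtain ⟨𝒬, h𝒬, hcard⟩ := Finset.exists_subset_card_eq (Nat.ceil_le.2 hk)
  refine ⟨2 ^ k, hNk.trans Nat.lt_two_pow_self.le, by positivity, 𝒬, fun q hq => ?_, ?_, ?_⟩
  · have h2 := Finset.mem_filter.1 (h𝒬 hq)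
    have h3 := Finset.mem_Ico.1 h2.1
    exact ⟨h2.2, h3.1, by rw [pow_succ'] at h3; exact h3.2.le⟩
  · rw [hcard]
    exact Nat.le_ceil _
  · rw [hcard]
    linarith [Nat.ceil_lt_add_one (zero_le_one.trans h1)]

/-- Points at relative position `b` in the grid cells of denominator `q`. -/
noncomputable def cellPt {n : ℕ} (b : Fin n → ℕ → ℝ) (q : ℕ) (p : Fin n → ℕ) : Fin n → ℝ :=
  fun i => (p i + b i q) / q

theorem card_le_of_abs_sub_lt (S : Finset ℤ) {x L : ℝ} (hL : 0 ≤ L)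
    (h : ∀ m ∈ S, |(m : ℝ) - x| < L) : (S.card : ℝ) ≤ 2 * L + 1 := by
  have h1 : S ⊆ Finset.Icc ⌈x - L⌉ ⌊x + L⌋ := by
    intro m hm
    have := abs_lt.1 (h m hm)
    rw [Finset.mem_Icc, Int.ceil_le, Int.le_floor]
    constructor <;> linarith
  have h2 := Finset.card_le_card h1
  rw [Int.card_Icc] at h2
  have h3 : (S.card : ℝ) ≤ ((⌊x + L⌋ + 1 - ⌈x - L⌉).toNat : ℝ) := by exact_mod_cast h2
  refine h3.trans ?_
  have h4 : (((⌊x + L⌋ + 1 - ⌈x - L⌉).toNat : ℤ) : ℝ) ≤ 2 * L + 1 := by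
    rw [Int.toNat_eq_max]
    push_cast
    refine max_le ?_ (by linarith)
    linarith [Int.floor_le (x + L), Int.le_ceil (x - L)]
  exact_mod_cast h4

theorem card_close_pairs_le {q q' : ℕ} (hq : q.Prime) (hq' : q'.Prime) (hne : q ≠ q') (b b' : ℝ)
    {δ : ℝ} (hδ : 0 ≤ δ) :
    ((((Finset.range q) ×ˢ (Finset.range q')).filter fun v : ℕ × ℕ =>
      |((v.1 : ℝ) + b) / q - (v.2 + b') / q'| < δ).card : ℝ) ≤ 2 * (δ * q * q') + 1 := by
  have hq0 : (0 : ℝ) < q := by exact_mod_cast hq.pos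
  have hq0' : (0 : ℝ) < q' := by exact_mod_cast hq'.pos
  set S := ((Finset.range q) ×ˢ (Finset.range q')).filter fun v : ℕ × ℕ =>
      |((v.1 : ℝ) + b) / q - (v.2 + b') / q'| < δ with hS
  have hinj : Set.InjOn (fun v : ℕ × ℕ => (v.1 : ℤ) * q' - v.2 * q) S := by
    intro v hv w hw hvw
    simp only [hS, Finset.coe_filter, Finset.mem_product, Finset.mem_range, mem_ofPred_eq] at hv hw
    simp only at hvw
    have hcop : IsCoprime (q : ℤ) q' := Nat.isCoprime_iff_coprime.2 ((Nat.coprime_primes hq hq').2 hne)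
    have h1 : (q : ℤ) ∣ (v.1 : ℤ) - w.1 := by
      refine hcop.dvd_of_dvd_mul_right ⟨(v.2 : ℤ) - w.2, ?_⟩
      linear_combination hvw
    have h2 : (v.1 : ℤ) - w.1 = 0 := by
      refine Int.eq_zero_of_abs_lt_dvd h1 ?_
      rw [abs_lt]
      have := hv.1.1
      have := hw.1.1
      omega
    have h3 : (v.2 : ℤ) = w.2 := by
      have h4 : ((v.2 : ℤ) - w.2) * q = 0 := by linear_combination (-1) * hvw + q' * h2
      have h5 : (q : ℤ) ≠ 0 := by exact_mod_cast hq.ne_zero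
      have := (mul_eq_zero.1 h4).resolve_right h5
      omega
    ext <;> omega
  rw [← Finset.card_image_of_injOn hinj]
  refine card_le_of_abs_sub_lt _ (x := b' * q - b * q') (by positivity) fun m hm => ?_
  obtain ⟨v, hv, rfl⟩ := Finset.mem_image.1 hm
  have h1 := (Finset.mem_filter.1 hv).2
  have h2 : (((v.1 : ℤ) * q' - v.2 * q : ℤ) : ℝ) - (b' * q - b * q') =
      (((v.1 : ℝ) + b) / q - (v.2 + b') / q') * (q * q') := by
    push_cast
    field_simp
    ring
  rw [h2, abs_mul, abs_of_pos (by positivity : (0 : ℝ) < q * q'), mul_assoc]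
  exact mul_lt_mul_of_pos_right h1 (by positivity)

open scoped Classical in
/-- The grid points of denominator `q` whose associated point is `δ`-close to one of another
denominator from `𝒬`. -/
noncomputable def conflictPts {n : ℕ} (b : Fin n → ℕ → ℝ) (δ : Fin n → ℝ) (𝒬 : Finset ℕ) (q : ℕ) :
    Finset (Fin n → ℕ) :=
  (gridPts n q).filter fun p => ∃ q' ∈ 𝒬, q' ≠ q ∧ ∃ p' ∈ gridPts n q',
    ∀ i, |cellPt b q p i - cellPt b q' p' i| < δ i

theorem card_conflictPts_le {n : ℕ} (b : Fin n → ℕ → ℝ) {δ K : Fin n → ℝ} (hδ : ∀ i, 0 ≤ δ i)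
    {𝒬 : Finset ℕ} {q : ℕ} (h𝒬 : ∀ q ∈ 𝒬, q.Prime) (hq : q ∈ 𝒬)
    (hK : ∀ q' ∈ 𝒬, ∀ i, 2 * (δ i * q * q') + 1 ≤ K i) :
    ((conflictPts b δ 𝒬 q).card : ℝ) ≤ 𝒬.card * ∏ i, K i := by
  classical
  set V : ℕ → Finset (Fin n → ℕ × ℕ) := fun q' => Fintype.piFinset fun i =>
    ((Finset.range q) ×ˢ (Finset.range q')).filter fun v : ℕ × ℕ =>
      |((v.1 : ℝ) + b i q) / q - (v.2 + b i q') / q'| < δ i with hV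
  have hsub : conflictPts b δ 𝒬 q ⊆
      (𝒬.erase q).biUnion fun q' => (V q').image fun v i => (v i).1 := by
    intro p hp
    obtain ⟨hp, q', hq', hne, p', hp', hclose⟩ := Finset.mem_filter.1 hp
    refine Finset.mem_biUnion.2 ⟨q', Finset.mem_erase.2 ⟨hne, hq'⟩, Finset.mem_image.2
      ⟨fun i => (p i, p' i), Fintype.mem_piFinset.2 fun i => ?_, rfl⟩⟩
    exact Finset.mem_filter.2 ⟨Finset.mem_product.2
      ⟨Fintype.mem_piFinset.1 hp i, Fintype.mem_piFinset.1 hp' i⟩, hclose i⟩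
  have hVcard : ∀ q' ∈ 𝒬.erase q, ((V q').card : ℝ) ≤ ∏ i, K i := by
    intro q' hq'
    rw [Finset.mem_erase] at hq'
    rw [hV]
    simp only [Fintype.card_piFinset]
    push_cast
    refine Finset.prod_le_prod (fun i _ => by positivity) fun i _ => ?_
    exact (card_close_pairs_le (h𝒬 q hq) (h𝒬 q' hq'.2) hq'.1.symm _ _ (hδ i)).trans
      (hK q' hq'.2 i)
  have hK0 : 0 ≤ ∏ i, K i := Finset.prod_nonneg fun i _ => by
    have h1 := hK q hq i
    have h2 : 0 ≤ δ i * q * q := mul_nonneg (mul_nonneg (hδ i) (by positivity)) (by positivity)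
    linarith
  calc ((conflictPts b δ 𝒬 q).card : ℝ)
      ≤ (((𝒬.erase q).biUnion fun q' => (V q').image fun v i => (v i).1).card : ℝ) := by
        exact_mod_cast Finset.card_le_card hsub
    _ ≤ ∑ q' ∈ 𝒬.erase q, ((V q').card : ℝ) := by
        refine (Nat.cast_le.2 (Finset.card_biUnion_le.trans
          (Finset.sum_le_sum fun q' _ => Finset.card_image_le))).trans ?_
        push_cast
        rfl
    _ ≤ ∑ q' ∈ 𝒬.erase q, ∏ i, K i := Finset.sum_le_sum hVcard
    _ = (𝒬.erase q).card * ∏ i, K i := by rw [Finset.sum_const, nsmul_eq_mul]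
    _ ≤ _ := by
        gcongr
        exact Finset.erase_subset q 𝒬

/-- Points attached to distinct non-conflicting grid points are separated. -/
theorem exists_le_abs_sub_cellPt {n : ℕ} (b : Fin n → ℕ → ℝ) {δ : Fin n → ℝ} {𝒬 : Finset ℕ}
    {q q' : ℕ} (hq0 : 0 < q) (hδ : ∀ i, δ i ≤ 1 / q) (hq' : q' ∈ 𝒬)
    {p p' : Fin n → ℕ} (hp : p ∈ gridPts n q \ conflictPts b δ 𝒬 q) (hp' : p' ∈ gridPts n q')
    (hne : q = q' → p ≠ p') :
    ∃ i, δ i ≤ |cellPt b q p i - cellPt b q' p' i| := by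
  classical
  by_cases hqq : q' = q
  · subst hqq
    have hpp : p ≠ p' := hne rfl
    obtain ⟨i, hi⟩ := Function.ne_iff.1 hpp
    refine ⟨i, (hδ i).trans ?_⟩
    have hq0' : (0 : ℝ) < q' := by exact_mod_cast hq0
    have h1 : cellPt b q' p i - cellPt b q' p' i = ((p i : ℤ) - p' i : ℤ) / q' := by
      simp only [cellPt]
      push_cast
      ring
    rw [h1, abs_div, abs_of_pos hq0']
    gcongr
    have h2 : (1 : ℤ) ≤ |(p i : ℤ) - p' i| := Int.one_le_abs (by omega)
    exact_mod_cast h2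
  · by_contra! h
    rw [Finset.mem_sdiff] at hp
    exact hp.2 (Finset.mem_filter.2 ⟨hp.1, q', hq', hqq, p', hp', h⟩)

theorem card_le_of_separated {ι : Type*} {n : ℕ} (A : Finset ι) (z : ι → Fin n → ℝ)
    {δ ρ x : Fin n → ℝ} (hδ : ∀ i, 0 < δ i) (hρ : ∀ i, 0 ≤ ρ i)
    (hsep : ∀ a ∈ A, ∀ a' ∈ A, a ≠ a' → ∃ i, δ i ≤ |z a i - z a' i|)
    (hz : ∀ a ∈ A, ∀ i, |z a i - x i| ≤ ρ i) :
    (A.card : ℝ) ≤ ∏ i, (2 * ρ i / δ i + 2) := by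
  classical
  set φ : ι → Fin n → ℤ := fun a i => ⌊z a i / δ i⌋ with hφ
  have hinj : Set.InjOn φ A := by
    intro a ha a' ha' h
    by_contra hne
    obtain ⟨i, hi⟩ := hsep a ha a' ha' hne
    have h1 : ⌊z a i / δ i⌋ = ⌊z a' i / δ i⌋ := congrFun h i
    have h2 := Int.abs_sub_lt_one_of_floor_eq_floor h1
    rw [← sub_div, abs_div, abs_of_pos (hδ i), div_lt_one (hδ i)] at h2
    linarith
  have hsub : A.image φ ⊆ Fintype.piFinset fun i =>
      Finset.Icc ⌊(x i - ρ i) / δ i⌋ ⌊(x i + ρ i) / δ i⌋ := by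
    intro m hm
    obtain ⟨a, ha, rfl⟩ := Finset.mem_image.1 hm
    refine Fintype.mem_piFinset.2 fun i => Finset.mem_Icc.2 ?_
    have h1 := abs_le.1 (hz a ha i)
    have hδi := hδ i
    constructor <;> refine Int.floor_mono ?_ <;> gcongr <;> linarith
  have hcard := Finset.card_le_card hsub
  rw [Finset.card_image_of_injOn hinj, Fintype.card_piFinset] at hcard
  calc (A.card : ℝ) ≤ ((∏ i, (Finset.Icc ⌊(x i - ρ i) / δ i⌋ ⌊(x i + ρ i) / δ i⌋).card : ℕ) : ℝ) :=
        by exact_mod_cast hcard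
    _ ≤ _ := by
        push_cast
        refine Finset.prod_le_prod (fun i _ => by positivity) fun i _ => ?_
        have hδi := hδ i
        have hρi := hρ i
        have h0 : (0 : ℝ) ≤ 2 * ρ i / δ i + 2 := by positivity
        rw [Int.card_Icc]
        have h4 : (((⌊(x i + ρ i) / δ i⌋ + 1 - ⌊(x i - ρ i) / δ i⌋).toNat : ℤ) : ℝ) ≤
            2 * ρ i / δ i + 2 := by
          rw [Int.toNat_eq_max]
          push_cast
          refine max_le ?_ h0
          have h5 : (x i + ρ i) / δ i - (x i - ρ i) / δ i = 2 * ρ i / δ i := by ring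
          linarith [Int.floor_le ((x i + ρ i) / δ i), Int.sub_one_lt_floor ((x i - ρ i) / δ i)]
        exact_mod_cast h4

/-- Mass given to a ball by a family of box densities with separated centres. -/
theorem sum_setIntegral_boxTent_le {ι : Type*} {n : ℕ} (A : Finset ι) (z w : ι → Fin n → ℝ)
    {δ W : Fin n → ℝ} (hW : ∀ i, 0 < W i) (hWw : ∀ a ∈ A, ∀ i, W i ≤ w a i)
    (hwδ : ∀ a ∈ A, ∀ i, w a i ≤ δ i) (hδ : ∀ i, 0 < δ i)
    (hsep : ∀ a ∈ A, ∀ a' ∈ A, a ≠ a' → ∃ i, δ i ≤ |z a i - z a' i|)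
    (x : Fin n → ℝ) {r : ℝ} (hr : 0 < r) :
    ∑ a ∈ A, ∫ y in Metric.closedBall x r, boxTent (z a) (w a) y ≤
      ∏ i, ((2 * r / δ i + 4) * min 1 (2 * r / W i)) := by
  classical
  set F : ι → ℝ := fun a => ∫ y in Metric.closedBall x r, boxTent (z a) (w a) y with hF
  set A' := A.filter fun a => F a ≠ 0 with hA'
  have hw : ∀ a ∈ A, ∀ i, 0 < w a i := fun a ha i => (hW i).trans_le (hWw a ha i)
  have hFle : ∀ a ∈ A', F a ≤ ∏ i, min 1 (2 * r / W i) := by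
    intro a ha
    have ha := (Finset.mem_filter.1 ha).1
    refine (setIntegral_boxTent_le (hw a ha) x hr).trans ?_
    refine Finset.prod_le_prod (fun i _ => ?_) fun i _ => ?_
    · have := hw a ha i
      positivity
    · have := hW i
      have := hWw a ha i
      gcongr
  have hclose : ∀ a ∈ A', ∀ i, |z a i - x i| ≤ r + δ i := by
    intro a ha i
    obtain ⟨ha, hne⟩ := Finset.mem_filter.1 ha
    obtain ⟨y, hy, hyne⟩ : ∃ y ∈ Metric.closedBall x r, boxTent (z a) (w a) y ≠ 0 := by
      by_contra! h
      exact hne (setIntegral_eq_zero_of_forall_eq_zero h)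
    have h1 := abs_le.1 (abs_sub_le_of_boxTent_ne_zero (hw a ha) hyne i)
    have h2 : |y i - x i| ≤ r := (dist_le_pi_dist y x i).trans hy
    have h3 := abs_le.1 h2
    have h4 := hwδ a ha i
    rw [abs_le]
    constructor <;> linarith
  have hcard := card_le_of_separated A' z hδ (fun i => (add_pos hr (hδ i)).le)
    (fun a ha a' ha' => hsep a (Finset.mem_filter.1 ha).1 a' (Finset.mem_filter.1 ha').1) hclose
  have hmin0 : 0 ≤ ∏ i, min 1 (2 * r / W i) := Finset.prod_nonneg fun i _ => by
    have := hW i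
    positivity
  calc ∑ a ∈ A, F a = ∑ a ∈ A', F a := (Finset.sum_filter_ne_zero A).symm
    _ ≤ ∑ a ∈ A', ∏ i, min 1 (2 * r / W i) := Finset.sum_le_sum hFle
    _ = A'.card * ∏ i, min 1 (2 * r / W i) := by rw [Finset.sum_const, nsmul_eq_mul]
    _ ≤ (∏ i, (2 * (r + δ i) / δ i + 2)) * ∏ i, min 1 (2 * r / W i) := by gcongr
    _ = _ := by
        rw [← Finset.prod_mul_distrib]
        refine Finset.prod_congr rfl fun i _ => ?_
        have := hδ i
        congr 1
        field_simp
        ring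

theorem prod_max_mul_min_le {n : ℕ} {t : Fin n → ℝ} {s σ c : ℝ} (hsn : s < n)
    (hc : 0 ≤ c) (hσ : ∑ i, min (t i) c = σ)
    (hk : ∀ k, s * (1 + t k) ≤ n + σ + ∑ i, max 0 (t k - t i)) {Q r : ℝ} (hQ : 1 < Q)
    (hr : 0 < r) (hr1 : r ≤ 1) :
    ∏ i, (max 1 (r * Q ^ (1 + min (t i) c)) * min 1 (r * Q ^ (1 + t i))) ≤
      Q ^ (n + σ) * r ^ s := by
  have hQ0 : 0 < Q := zero_lt_one.trans hQ
  have hlog : 0 < Real.log Q := Real.log_pos hQ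
  obtain ⟨u, hu, rfl⟩ : ∃ u : ℝ, 0 ≤ u ∧ Q ^ (-u) = r := by
    refine ⟨-(Real.log r / Real.log Q), ?_, ?_⟩
    · rw [← neg_div]
      exact div_nonneg (by linarith [Real.log_nonpos hr.le hr1]) hlog.le
    · rw [neg_neg, Real.rpow_def_of_pos hQ0, mul_div_cancel₀ _ hlog.ne', Real.exp_log hr]
  have hmono : Monotone fun e : ℝ => Q ^ e := fun a b h =>
    Real.rpow_le_rpow_of_exponent_le hQ.le h
  have hterm : ∀ i, max 1 (Q ^ (-u) * Q ^ (1 + min (t i) c)) * min 1 (Q ^ (-u) * Q ^ (1 + t i)) =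
      Q ^ (1 + min (t i) c - (min (1 + min (t i) c) u + max 0 (u - 1 - t i))) := by
    intro i
    rw [← Real.rpow_add hQ0, ← Real.rpow_add hQ0]
    have h1 : max 1 (Q ^ (-u + (1 + min (t i) c))) = Q ^ (max 0 (-u + (1 + min (t i) c))) := by
      have := hmono.map_max (a := 0) (b := -u + (1 + min (t i) c))
      simpa using this.symm
    have h2 : min 1 (Q ^ (-u + (1 + t i))) = Q ^ (min 0 (-u + (1 + t i))) := by
      have := hmono.map_min (a := 0) (b := -u + (1 + t i))
      simpa using this.symm
    rw [h1, h2, ← Real.rpow_add hQ0]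
    congr 1
    have h3 : max 0 (-u + (1 + min (t i) c)) = 1 + min (t i) c - min (1 + min (t i) c) u := by
      rcases le_total (1 + min (t i) c) u with h | h
      · rw [min_eq_left h, max_eq_left (by linarith)]
        ring
      · rw [min_eq_right h, max_eq_right (by linarith)]
        ring
    have h4 : min 0 (-u + (1 + t i)) = -max 0 (u - 1 - t i) := by
      rw [← min_neg_neg, neg_zero]
      congr 1
      ring
    rw [h3, h4]
    ring
  rw [Finset.prod_congr rfl fun i _ => hterm i, ← Real.rpow_sum_of_pos hQ0,
    ← Real.rpow_mul hQ0.le, ← Real.rpow_add hQ0]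
  refine hmono ?_
  have h5 := mul_le_sum_min_add_max hsn hc hσ hk hu
  rw [Finset.sum_sub_distrib, Finset.sum_add_distrib, hσ]
  simp only [Finset.sum_const, Finset.card_univ, Fintype.card_fin, nsmul_eq_mul, mul_one]
  linarith

/-- A family of about `Q ^ β` primes of size about `Q`. -/
structure IsPrimeBlock (Q : ℕ) (β : ℝ) (𝒬 : Finset ℕ) : Prop where
  pos : 0 < Q
  prime : ∀ q ∈ 𝒬, q.Prime
  ge : ∀ q ∈ 𝒬, Q ≤ q
  le : ∀ q ∈ 𝒬, q ≤ 2 * Q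
  card_ge : (Q : ℝ) ^ β ≤ 𝒬.card
  card_le : (𝒬.card : ℝ) ≤ 2 * (Q : ℝ) ^ β

/-- The half-widths of the target boxes of denominator `q`. -/
noncomputable def boxRad {n : ℕ} (t : Fin n → ℝ) (q : ℕ) : Fin n → ℝ :=
  fun i => (q : ℝ) ^ (-(1 + t i)) / 4

/-- The relative positions `b` keep the target boxes inside the grid cells. -/
def FitsInCells {n : ℕ} (t : Fin n → ℝ) (b : Fin n → ℕ → ℝ) : Prop :=
  ∀ i (q : ℕ), 0 < q → (q : ℝ) ^ (-(t i)) / 4 ≤ b i q ∧ b i q ≤ 1 - (q : ℝ) ^ (-(t i)) / 4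

/-- The separation between non-conflicting points. -/
noncomputable def sepRad {n : ℕ} (a : Fin n → ℝ) (Q : ℕ) : Fin n → ℝ :=
  fun i => (Q : ℝ) ^ (-(1 + a i)) / 2

/-- The numerators of the non-conflicting points of denominator `q`. -/
noncomputable def goodPts {n : ℕ} (b : Fin n → ℕ → ℝ) (a : Fin n → ℝ) (Q : ℕ) (𝒬 : Finset ℕ)
    (q : ℕ) : Finset (Fin n → ℕ) :=
  gridPts n q \ conflictPts b (sepRad a Q) 𝒬 q

/-- The average over `𝒬` of the densities of the non-conflicting boxes. -/
noncomputable def blockDensity {n : ℕ} (t : Fin n → ℝ) (b : Fin n → ℕ → ℝ) (a : Fin n → ℝ)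
    (Q : ℕ) (𝒬 : Finset ℕ) (x : Fin n → ℝ) : ℝ :=
  (𝒬.card : ℝ)⁻¹ * ∑ q ∈ 𝒬, ∑ p ∈ goodPts b a Q 𝒬 q,
    ((q : ℝ) ^ n)⁻¹ * boxTent (cellPt b q p) (boxRad t q) x

theorem boxRad_pos {n : ℕ} (t : Fin n → ℝ) {q : ℕ} (hq : 0 < q) (i : Fin n) : 0 < boxRad t q i := by
  have : (0 : ℝ) < q := by exact_mod_cast hq
  unfold boxRad
  positivity

theorem boxRad_eq {n : ℕ} (t : Fin n → ℝ) {q : ℕ} (hq : 0 < q) (i : Fin n) :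
    boxRad t q i = (q : ℝ) ^ (-(t i)) / 4 / q := by
  have : (0 : ℝ) < q := by exact_mod_cast hq
  rw [boxRad, neg_add, Real.rpow_add this, Real.rpow_neg_one]
  field_simp

theorem FitsInCells.le_sub {n : ℕ} {t : Fin n → ℝ} {b : Fin n → ℕ → ℝ} (h : FitsInCells t b)
    {q : ℕ} (hq : 0 < q) (p : Fin n → ℕ) (i : Fin n) :
    (p i : ℝ) / q ≤ cellPt b q p i - boxRad t q i := by
  have : (0 : ℝ) < q := by exact_mod_cast hq
  rw [boxRad_eq t hq, cellPt, ← sub_div]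
  refine div_le_div_of_nonneg_right ?_ this.le
  linarith [(h i q hq).1]

theorem FitsInCells.add_le {n : ℕ} {t : Fin n → ℝ} {b : Fin n → ℕ → ℝ} (h : FitsInCells t b)
    {q : ℕ} (hq : 0 < q) (p : Fin n → ℕ) (i : Fin n) :
    cellPt b q p i + boxRad t q i ≤ ((p i : ℝ) + 1) / q := by
  have : (0 : ℝ) < q := by exact_mod_cast hq
  rw [boxRad_eq t hq, cellPt, ← add_div]
  refine div_le_div_of_nonneg_right ?_ this.le
  linarith [(h i q hq).2]

theorem blockDensity_continuous {n : ℕ} (t : Fin n → ℝ) (b : Fin n → ℕ → ℝ) (a : Fin n → ℝ)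
    (Q : ℕ) (𝒬 : Finset ℕ) : Continuous (blockDensity t b a Q 𝒬) :=
  continuous_const.mul (continuous_finsetSum _ fun _ _ => continuous_finsetSum _ fun _ _ =>
    continuous_const.mul (boxTent_continuous _ _))

theorem blockDensity_nonneg {n : ℕ} (t : Fin n → ℝ) (b : Fin n → ℕ → ℝ) (a : Fin n → ℝ)
    {Q : ℕ} {𝒬 : Finset ℕ} (h𝒬 : ∀ q ∈ 𝒬, 0 < q) (x : Fin n → ℝ) : 0 ≤ blockDensity t b a Q 𝒬 x :=
  mul_nonneg (by positivity) (Finset.sum_nonneg fun q hq => Finset.sum_nonneg fun p _ =>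
    mul_nonneg (by positivity) (boxTent_nonneg _ (boxRad_pos t (h𝒬 q hq)) x))

theorem setIntegral_mul_blockDensity {n : ℕ} (t : Fin n → ℝ) (b : Fin n → ℕ → ℝ) (a : Fin n → ℝ)
    {Q : ℕ} {𝒬 : Finset ℕ} (h𝒬 : ∀ q ∈ 𝒬, 0 < q) {g : (Fin n → ℝ) → ℝ} (hg : Continuous g)
    (B : Set (Fin n → ℝ)) :
    ∫ y in B, g y * blockDensity t b a Q 𝒬 y = (𝒬.card : ℝ)⁻¹ * ∑ q ∈ 𝒬,
      ∑ p ∈ goodPts b a Q 𝒬 q, ((q : ℝ) ^ n)⁻¹ *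
        ∫ y in B, g y * boxTent (cellPt b q p) (boxRad t q) y := by
  have hInt : ∀ q ∈ 𝒬, ∀ p, Integrable (fun y => ((q : ℝ) ^ n)⁻¹ *
      (g y * boxTent (cellPt b q p) (boxRad t q) y)) (volume.restrict B) := by
    intro q hq p
    refine Integrable.const_mul (Integrable.integrableOn ?_) _
    exact (hg.mul (boxTent_continuous _ _)).integrable_of_hasCompactSupport
      (boxTent_hasCompactSupport (boxRad_pos t (h𝒬 q hq))).mul_left
  have h1 : ∀ y, g y * blockDensity t b a Q 𝒬 y = (𝒬.card : ℝ)⁻¹ * ∑ q ∈ 𝒬,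
      ∑ p ∈ goodPts b a Q 𝒬 q, ((q : ℝ) ^ n)⁻¹ *
        (g y * boxTent (cellPt b q p) (boxRad t q) y) := by
    intro y
    rw [blockDensity, mul_left_comm, Finset.mul_sum]
    congr 1
    refine Finset.sum_congr rfl fun q _ => ?_
    rw [Finset.mul_sum]
    exact Finset.sum_congr rfl fun p _ => by ring
  simp only [h1]
  rw [integral_const_mul, integral_finsetSum _ fun q hq => integrable_finsetSum _ fun p _ =>
    hInt q hq p]
  congr 1
  refine Finset.sum_congr rfl fun q hq => ?_
  rw [integral_finsetSum _ fun p _ => hInt q hq p]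
  exact Finset.sum_congr rfl fun p _ => integral_const_mul _ _

theorem IsPrimeBlock.card_pos {Q : ℕ} {β : ℝ} {𝒬 : Finset ℕ} (h : IsPrimeBlock Q β 𝒬) :
    (0 : ℝ) < 𝒬.card := by
  have : (0 : ℝ) < Q := by exact_mod_cast h.pos
  exact (Real.rpow_pos_of_pos this β).trans_le h.card_ge

theorem IsPrimeBlock.setIntegral_le {n : ℕ} {Q : ℕ} {β : ℝ} {𝒬 : Finset ℕ}
    (h : IsPrimeBlock Q β 𝒬) {t : Fin n → ℝ} {b : Fin n → ℕ → ℝ} (hb : FitsInCells t b)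
    (a : Fin n → ℝ) {g : (Fin n → ℝ) → ℝ}
    (hg : Continuous g) (hgi : Integrable g) (hg0 : ∀ x, 0 ≤ g x) {M : ℝ} (hM : ∀ x, g x ≤ M)
    {ω : ℝ} (hω : ∀ x y, dist x y ≤ 1 / Q → |g x - g y| ≤ ω)
    {s θ : ℝ} (hθ0 : 0 < θ) (hθ1 : θ ≤ 1) (hθs : θ ≤ n - s)
    (x : Fin n → ℝ) {r : ℝ} (hQr : 1 / Q ≤ r) (hr : r ≤ 1) :
    ∫ y in Metric.closedBall x r, g y * blockDensity t b a Q 𝒬 y ≤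
      (∫ y in Metric.closedBall x r, g y) +
        (M * (2 * n * 6 ^ n * (1 / Q) ^ θ) + 2 * ω * 6 ^ n) * r ^ s := by
  have hQ : (0 : ℝ) < Q := by exact_mod_cast h.pos
  have hr0 : 0 < r := (by positivity : (0 : ℝ) < 1 / Q).trans_le hQr
  have hM0 : 0 ≤ M := (hg0 0).trans (hM 0)
  rw [setIntegral_mul_blockDensity t b a (fun q hq => (h.prime q hq).pos) hg,
    inv_mul_le_iff₀ h.card_pos, ← nsmul_eq_mul]
  refine Finset.sum_le_card_nsmul _ _ _ fun q hq => ?_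
  have hq0 := (h.prime q hq).pos
  have hqQ : (1 : ℝ) / q ≤ 1 / Q := by
    have : (Q : ℝ) ≤ q := by exact_mod_cast h.ge q hq
    gcongr
  refine (sum_setIntegral_mul_boxTent_le_add hq0 hg hgi hg0 hM
    (fun x y hxy => hω x y (hxy.trans hqQ)) (boxRad_pos t hq0) (hb.le_sub hq0) (hb.add_le hq0)
    _ hθ0 hθ1 hθs x (hqQ.trans hQr) hr).trans ?_
  gcongr

theorem IsPrimeBlock.card_conflictPts_le {n : ℕ} {Q : ℕ} {β : ℝ} {𝒬 : Finset ℕ}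
    (h : IsPrimeBlock Q β 𝒬) (b : Fin n → ℕ → ℝ) {a : Fin n → ℝ} (ha : ∀ i, a i ≤ 1)
    {q : ℕ} (hq : q ∈ 𝒬) :
    ((q : ℝ) ^ n)⁻¹ * (conflictPts b (sepRad a Q) 𝒬 q).card ≤
      2 * 5 ^ n * (Q : ℝ) ^ (β - ∑ i, a i) := by
  have hQ : (0 : ℝ) < Q := by exact_mod_cast h.pos
  have hQ1 : (1 : ℝ) ≤ Q := by exact_mod_cast h.pos
  have hqQ : (Q : ℝ) ≤ q := by exact_mod_cast h.ge q hq
  have hle : ∀ q ∈ 𝒬, (q : ℝ) ≤ 2 * Q := fun q hq => by exact_mod_cast h.le q hq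
  have hK : ∀ q' ∈ 𝒬, ∀ i, 2 * (sepRad a Q i * q * q') + 1 ≤ 5 * (Q : ℝ) ^ (1 - a i) := by
    intro q' hq' i
    have h1 : (1 : ℝ) ≤ (Q : ℝ) ^ (1 - a i) := Real.one_le_rpow hQ1 (by linarith [ha i])
    have h2 : sepRad a Q i * (2 * Q) * (2 * Q) = 2 * (Q : ℝ) ^ (1 - a i) := by
      have : (Q : ℝ) ^ (1 - a i) = (Q : ℝ) ^ (-(1 + a i)) * Q * Q := by
        rw [← Real.rpow_add_one hQ.ne', ← Real.rpow_add_one hQ.ne']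
        congr 1
        ring
      rw [this, sepRad]
      ring
    have h0 : 0 ≤ sepRad a Q i := by unfold sepRad; positivity
    have h3 : sepRad a Q i * q * q' ≤ sepRad a Q i * (2 * Q) * (2 * Q) := by
      have := hle q hq
      have := hle q' hq'
      gcongr
    linarith
  have h1 := _root_.card_conflictPts_le b (δ := sepRad a Q)
    (fun i => by unfold sepRad; positivity) h.prime hq hK
  have h2 : ∏ i, (5 * (Q : ℝ) ^ (1 - a i)) = 5 ^ n * (Q : ℝ) ^ ((n : ℝ) - ∑ i, a i) := by
    rw [Finset.prod_mul_distrib, ← Real.rpow_sum_of_pos hQ]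
    simp
  rw [h2] at h1
  calc _ ≤ ((Q : ℝ) ^ n)⁻¹ * (2 * (Q : ℝ) ^ β * (5 ^ n * (Q : ℝ) ^ ((n : ℝ) - ∑ i, a i))) := by
        have := h.card_le
        gcongr
        exact h1.trans (by gcongr)
    _ = 2 * 5 ^ n * ((Q : ℝ) ^ (-(n : ℝ)) * (Q : ℝ) ^ β * (Q : ℝ) ^ ((n : ℝ) - ∑ i, a i)) := by
        rw [Real.rpow_neg hQ.le, Real.rpow_natCast]
        ring
    _ = _ := by
        rw [← Real.rpow_add hQ, ← Real.rpow_add hQ]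
        congr 2
        ring

theorem IsPrimeBlock.le_setIntegral {n : ℕ} {Q : ℕ} {β : ℝ} {𝒬 : Finset ℕ}
    (h : IsPrimeBlock Q β 𝒬) {t : Fin n → ℝ} {b : Fin n → ℕ → ℝ} (hb : FitsInCells t b)
    {a : Fin n → ℝ} (ha : ∀ i, a i ≤ 1) {g : (Fin n → ℝ) → ℝ}
    (hg : Continuous g) (hgi : Integrable g) (hg0 : ∀ x, 0 ≤ g x) {M : ℝ} (hM : ∀ x, g x ≤ M)
    {ω : ℝ} (hω : ∀ x y, dist x y ≤ 1 / Q → |g x - g y| ≤ ω) :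
    (∫ y in unitCube n, g y) - (2 * ω + M * (2 * 5 ^ n * (Q : ℝ) ^ (β - ∑ i, a i))) ≤
      ∫ y in unitCube n, g y * blockDensity t b a Q 𝒬 y := by
  have hM0 : 0 ≤ M := (hg0 0).trans (hM 0)
  have hQ : (0 : ℝ) < Q := by exact_mod_cast h.pos
  rw [setIntegral_mul_blockDensity t b a (fun q hq => (h.prime q hq).pos) hg,
    le_inv_mul_iff₀ h.card_pos, ← nsmul_eq_mul]
  refine Finset.card_nsmul_le_sum _ _ _ fun q hq => ?_
  have hq0 := (h.prime q hq).pos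
  have hqQ : (1 : ℝ) / q ≤ 1 / Q := by
    have : (Q : ℝ) ≤ q := by exact_mod_cast h.ge q hq
    gcongr
  have h1 := le_sum_setIntegral_mul_boxTent hq0 hg hgi
    (fun x y hxy => hω x y (hxy.trans hqQ)) (boxRad_pos t hq0) (hb.le_sub hq0) (hb.add_le hq0)
  have hsub : conflictPts b (sepRad a Q) 𝒬 q ⊆ gridPts n q := Finset.filter_subset _ _
  rw [← Finset.sum_sdiff hsub] at h1
  have h2 : ∑ p ∈ conflictPts b (sepRad a Q) 𝒬 q, ((q : ℝ) ^ n)⁻¹ *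
      ∫ y in unitCube n, g y * boxTent (cellPt b q p) (boxRad t q) y ≤
        M * (2 * 5 ^ n * (Q : ℝ) ^ (β - ∑ i, a i)) := by
    have hw := boxRad_pos t hq0
    have h3 : ∀ p, ∫ y in unitCube n, g y * boxTent (cellPt b q p) (boxRad t q) y ≤ M := by
      intro p
      have hbi := boxTent_integrable (c := cellPt b q p) hw
      calc _ ≤ ∫ y in unitCube n, M * boxTent (cellPt b q p) (boxRad t q) y := by
            refine setIntegral_mono ?_ (hbi.const_mul _).integrableOn fun y =>
              mul_le_mul_of_nonneg_right (hM y) (boxTent_nonneg _ hw y)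
            exact ((hg.mul (boxTent_continuous _ _)).integrable_of_hasCompactSupport
              (boxTent_hasCompactSupport hw).mul_left).integrableOn
        _ = M * ∫ y in unitCube n, boxTent (cellPt b q p) (boxRad t q) y :=
            integral_const_mul _ _
        _ ≤ M * ∫ y, boxTent (cellPt b q p) (boxRad t q) y := by
            refine mul_le_mul_of_nonneg_left ?_ hM0
            exact setIntegral_le_integral hbi (Eventually.of_forall (boxTent_nonneg _ hw))
        _ = M := by rw [integral_boxTent hw, mul_one]
    calc _ ≤ ∑ p ∈ conflictPts b (sepRad a Q) 𝒬 q, ((q : ℝ) ^ n)⁻¹ * M :=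
          Finset.sum_le_sum fun p _ => mul_le_mul_of_nonneg_left (h3 p) (by positivity)
      _ = M * (((q : ℝ) ^ n)⁻¹ * (conflictPts b (sepRad a Q) 𝒬 q).card) := by
          rw [Finset.sum_const, nsmul_eq_mul]
          ring
      _ ≤ _ := mul_le_mul_of_nonneg_left (h.card_conflictPts_le b ha hq) hM0
  unfold goodPts
  linarith

theorem min_one_mul_le {K y : ℝ} (hK : 1 ≤ K) : min 1 (K * y) ≤ K * min 1 y := by
  rw [mul_min_of_nonneg _ _ (zero_le_one.trans hK), mul_one]
  exact min_le_min_right _ hK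

theorem IsPrimeBlock.setIntegral_le_of_small {n : ℕ} {Q : ℕ} {β : ℝ} {𝒬 : Finset ℕ}
    (h : IsPrimeBlock Q β 𝒬) (hQ1 : 1 < Q) {t : Fin n → ℝ} (ht : ∀ i, 0 < t i)
    (b : Fin n → ℕ → ℝ) {s s' σ c : ℝ} (hsn : s' < n) (hss : s ≤ s')
    (hc : 0 ≤ c) (hσ : ∑ i, min (t i) c = σ) (hσ1 : σ ≤ 1)
    (hk : ∀ k, s' * (1 + t k) ≤ n + σ + ∑ i, max 0 (t k - t i))
    {g : (Fin n → ℝ) → ℝ} (hg : Continuous g) (hg0 : ∀ x, 0 ≤ g x) {M : ℝ} (hM : ∀ x, g x ≤ M)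
    (x : Fin n → ℝ) {r : ℝ} (hr : 0 < r) (hrQ : r ≤ 1 / Q) :
    ∫ y in Metric.closedBall x r, g y * blockDensity t b (fun i => min (t i) c) Q 𝒬 y ≤
      M * ((∏ i, (64 * (2 : ℝ) ^ (1 + t i))) * (Q : ℝ) ^ (σ - β - (s' - s))) * r ^ s := by
  classical
  set a : Fin n → ℝ := fun i => min (t i) c with ha
  have hQ : (0 : ℝ) < Q := by exact_mod_cast h.pos
  have hQ1' : (1 : ℝ) < Q := by exact_mod_cast hQ1
  have hM0 : 0 ≤ M := (hg0 0).trans (hM 0)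
  have hr1 : r ≤ 1 := hrQ.trans ((div_le_one hQ).2 hQ1'.le)
  have ha0 : ∀ i, 0 ≤ a i := fun i => le_min (ht i).le hc
  have ha1 : ∀ i, a i ≤ 1 := fun i =>
    (Finset.single_le_sum (fun k _ => ha0 k) (Finset.mem_univ i)).trans (hσ.le.trans hσ1)
  have hpos : ∀ q ∈ 𝒬, 0 < q := fun q hq => (h.prime q hq).pos
  have hδ : ∀ i, 0 < sepRad a Q i := fun i => by unfold sepRad; positivity
  have hδq : ∀ q ∈ 𝒬, ∀ i, sepRad a Q i ≤ 1 / q := by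
    intro q hq i
    have h1 : (q : ℝ) ≤ 2 * Q := by exact_mod_cast h.le q hq
    have h2 : (0 : ℝ) < q := by exact_mod_cast hpos q hq
    calc sepRad a Q i ≤ (Q : ℝ) ^ (-1 : ℝ) / 2 := by
          unfold sepRad
          gcongr
          · exact hQ1'.le
          · linarith [ha0 i]
      _ = 1 / (2 * Q) := by
          rw [Real.rpow_neg_one]
          field_simp
      _ ≤ 1 / q := by gcongr
  set W : Fin n → ℝ := fun i => (2 * Q : ℝ) ^ (-(1 + t i)) / 4 with hW
  have hkey : ∑ q ∈ 𝒬, ∑ p ∈ goodPts b a Q 𝒬 q,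
      ∫ y in Metric.closedBall x r, boxTent (cellPt b q p) (boxRad t q) y ≤
        (∏ i, (64 * (2 : ℝ) ^ (1 + t i))) * ((Q : ℝ) ^ (n + σ) * r ^ s') := by
    rw [Finset.sum_sigma']
    refine (sum_setIntegral_boxTent_le (𝒬.sigma fun q => goodPts b a Q 𝒬 q)
      (fun v => cellPt b v.1 v.2) (fun v => boxRad t v.1) (δ := sepRad a Q) (W := W)
      (fun i => by positivity) ?_ ?_ hδ ?_ x hr).trans ?_
    · intro v hv i
      have hv1 := (Finset.mem_sigma.1 hv).1
      have h1 : (v.1 : ℝ) ≤ 2 * Q := by exact_mod_cast h.le _ hv1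
      have h2 : (0 : ℝ) < v.1 := by exact_mod_cast hpos _ hv1
      simp only [hW, boxRad]
      refine div_le_div_of_nonneg_right ?_ (by norm_num)
      exact Real.rpow_le_rpow_of_nonpos h2 h1 (by linarith [ht i])
    · intro v hv i
      have hv1 := (Finset.mem_sigma.1 hv).1
      have h1 : (Q : ℝ) ≤ v.1 := by exact_mod_cast h.ge _ hv1
      simp only [sepRad, boxRad]
      have h2 : (v.1 : ℝ) ^ (-(1 + t i)) ≤ (Q : ℝ) ^ (-(1 + t i)) :=
        Real.rpow_le_rpow_of_nonpos hQ h1 (by linarith [ht i])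
      have h3 : (Q : ℝ) ^ (-(1 + t i)) ≤ (Q : ℝ) ^ (-(1 + a i)) :=
        Real.rpow_le_rpow_of_exponent_le hQ1'.le (by linarith [min_le_left (t i) c])
      have h4 : 0 ≤ (Q : ℝ) ^ (-(1 + a i)) := by positivity
      linarith
    · rintro ⟨q, p⟩ hv ⟨q', p'⟩ hv' hne
      obtain ⟨hq, hp⟩ := Finset.mem_sigma.1 hv
      obtain ⟨hq', hp'⟩ := Finset.mem_sigma.1 hv'
      refine exists_le_abs_sub_cellPt b (hpos q hq) (hδq q hq) hq' hp (Finset.mem_sdiff.1 hp').1 ?_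
      rintro rfl rfl
      exact hne rfl
    · refine le_trans ?_ (mul_le_mul_of_nonneg_left
        (prod_max_mul_min_le hsn hc hσ hk hQ1' hr hr1) (by positivity))
      rw [← Finset.prod_mul_distrib]
      refine Finset.prod_le_prod (fun i _ => ?_) fun i _ => ?_
      · have := hδ i
        have : 0 < W i := by positivity
        positivity
      · have e1 : 2 * r / sepRad a Q i + 4 ≤ 8 * max 1 (r * (Q : ℝ) ^ (1 + a i)) := by
          have : 2 * r / sepRad a Q i = 4 * (r * (Q : ℝ) ^ (1 + a i)) := by
            rw [sepRad, Real.rpow_neg hQ.le]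
            field_simp
            ring
          rw [this]
          linarith [le_max_left 1 (r * (Q : ℝ) ^ (1 + a i)),
            le_max_right 1 (r * (Q : ℝ) ^ (1 + a i))]
        have e2 : min 1 (2 * r / W i) ≤
            (8 * (2 : ℝ) ^ (1 + t i)) * min 1 (r * (Q : ℝ) ^ (1 + t i)) := by
          have : 2 * r / W i = (8 * (2 : ℝ) ^ (1 + t i)) * (r * (Q : ℝ) ^ (1 + t i)) := by
            simp only [hW]
            rw [Real.rpow_neg (by positivity), Real.mul_rpow two_pos.le hQ.le]
            field_simp
            ring
          rw [this]
          refine min_one_mul_le ?_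
          have := Real.one_le_rpow one_le_two (by linarith [ht i] : 0 ≤ 1 + t i)
          linarith
        have e3 : 0 ≤ min 1 (2 * r / W i) := by
          have : 0 < W i := by positivity
          positivity
        calc _ ≤ (8 * max 1 (r * (Q : ℝ) ^ (1 + a i))) *
              ((8 * (2 : ℝ) ^ (1 + t i)) * min 1 (r * (Q : ℝ) ^ (1 + t i))) := by gcongr
          _ = _ := by ring
  have hr_s : r ^ s' ≤ (Q : ℝ) ^ (-(s' - s)) * r ^ s := by
    have e1 : r ^ s' = r ^ (s' - s) * r ^ s := by
      rw [← Real.rpow_add hr]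
      congr 1
      ring
    have e2 : r ^ (s' - s) ≤ (1 / (Q : ℝ)) ^ (s' - s) :=
      Real.rpow_le_rpow hr.le hrQ (by linarith)
    rw [one_div, Real.inv_rpow hQ.le, ← Real.rpow_neg hQ.le] at e2
    rw [e1]
    gcongr
  rw [setIntegral_mul_blockDensity t b a hpos hg]
  set C := ∏ i, (64 * (2 : ℝ) ^ (1 + t i)) with hC
  have hC0 : 0 ≤ C := by positivity
  have hterm : ∀ q ∈ 𝒬, ∀ p, ((q : ℝ) ^ n)⁻¹ *
      ∫ y in Metric.closedBall x r, g y * boxTent (cellPt b q p) (boxRad t q) y ≤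
        ((Q : ℝ) ^ n)⁻¹ * M *
          ∫ y in Metric.closedBall x r, boxTent (cellPt b q p) (boxRad t q) y := by
    intro q hq p
    have hqQ : (Q : ℝ) ≤ q := by exact_mod_cast h.ge q hq
    have hw := boxRad_pos t (hpos q hq)
    have hbi := boxTent_integrable (c := cellPt b q p) hw
    have h1 : ∫ y in Metric.closedBall x r, g y * boxTent (cellPt b q p) (boxRad t q) y ≤
        M * ∫ y in Metric.closedBall x r, boxTent (cellPt b q p) (boxRad t q) y := by
      rw [← integral_const_mul]
      refine setIntegral_mono ?_ (hbi.const_mul _).integrableOn fun y =>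
        mul_le_mul_of_nonneg_right (hM y) (boxTent_nonneg _ hw y)
      exact ((hg.mul (boxTent_continuous _ _)).integrable_of_hasCompactSupport
        (boxTent_hasCompactSupport hw).mul_left).integrableOn
    have h2 : 0 ≤ ∫ y in Metric.closedBall x r, g y * boxTent (cellPt b q p) (boxRad t q) y :=
      integral_nonneg fun y => mul_nonneg (hg0 y) (boxTent_nonneg _ hw y)
    rw [mul_assoc]
    gcongr
  calc _ ≤ (𝒬.card : ℝ)⁻¹ * ∑ q ∈ 𝒬, ∑ p ∈ goodPts b a Q 𝒬 q, ((Q : ℝ) ^ n)⁻¹ * M *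
          ∫ y in Metric.closedBall x r, boxTent (cellPt b q p) (boxRad t q) y := by
        refine mul_le_mul_of_nonneg_left ?_ (by positivity)
        exact Finset.sum_le_sum fun q hq => Finset.sum_le_sum fun p _ => hterm q hq p
    _ = (𝒬.card : ℝ)⁻¹ * (((Q : ℝ) ^ n)⁻¹ * M * ∑ q ∈ 𝒬, ∑ p ∈ goodPts b a Q 𝒬 q,
          ∫ y in Metric.closedBall x r, boxTent (cellPt b q p) (boxRad t q) y) := by
        simp only [Finset.mul_sum]
    _ ≤ ((Q : ℝ) ^ β)⁻¹ * (((Q : ℝ) ^ n)⁻¹ * M * (C * ((Q : ℝ) ^ (n + σ) *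
          ((Q : ℝ) ^ (-(s' - s)) * r ^ s)))) := by
        have h1 := h.card_ge
        have h2 : (0 : ℝ) < (Q : ℝ) ^ β := by positivity
        have h3 : 0 ≤ ∑ q ∈ 𝒬, ∑ p ∈ goodPts b a Q 𝒬 q,
            ∫ y in Metric.closedBall x r, boxTent (cellPt b q p) (boxRad t q) y :=
          Finset.sum_nonneg fun q hq => Finset.sum_nonneg fun p _ =>
            integral_nonneg fun y => boxTent_nonneg _ (boxRad_pos t (hpos q hq)) y
        gcongr
        exact hkey.trans (by gcongr)
    _ = M * (C * ((Q : ℝ) ^ (-β) * (Q : ℝ) ^ (-(n : ℝ)) * (Q : ℝ) ^ (n + σ) *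
          (Q : ℝ) ^ (-(s' - s)))) * r ^ s := by
        rw [Real.rpow_neg hQ.le β, Real.rpow_neg hQ.le (n : ℝ), Real.rpow_natCast]
        ring
    _ = _ := by
        rw [← Real.rpow_add hQ, ← Real.rpow_add hQ, ← Real.rpow_add hQ]
        congr 4
        ring

theorem exists_perturbed_exponents {n : ℕ} {t : Fin n → ℝ} {s : ℝ} (hsn : s < n)
    (hs : ∀ k, s * (1 + t k) < n + 1 + ∑ i, max 0 (t k - t i)) :
    ∃ s' σ : ℝ, s < s' ∧ s' < n ∧ 0 < σ ∧ σ ≤ 1 ∧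
      ∀ k, s' * (1 + t k) ≤ n + σ + ∑ i, max 0 (t k - t i) := by
  have h1 : ∀ᶠ η in nhdsWithin (0 : ℝ) (Ioi 0), ∀ k,
      (s + η) * (1 + t k) < n + (1 - η) + ∑ i, max 0 (t k - t i) := by
    refine eventually_all.2 fun k => ?_
    refine (ContinuousAt.eventually_lt (f := fun η : ℝ => (s + η) * (1 + t k))
      (g := fun η : ℝ => n + (1 - η) + ∑ i, max 0 (t k - t i)) (by fun_prop) (by fun_prop)
      ?_).filter_mono nhdsWithin_le_nhds
    simpa using hs k
  have h2 : ∀ᶠ η in nhdsWithin (0 : ℝ) (Ioi 0), s + η < n := by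
    refine (ContinuousAt.eventually_lt (f := fun η : ℝ => s + η) (g := fun _ => (n : ℝ))
      (by fun_prop) (by fun_prop) (by simpa using hsn)).filter_mono nhdsWithin_le_nhds
  have h3 : ∀ᶠ η in nhdsWithin (0 : ℝ) (Ioi 0), η < 1 :=
    (gt_mem_nhds zero_lt_one).filter_mono nhdsWithin_le_nhds
  obtain ⟨η, hη1, hη2, hη3, hη0⟩ :=
    (h1.and (h2.and (h3.and self_mem_nhdsWithin))).exists
  have hη0 : 0 < η := hη0
  exact ⟨s + η, 1 - η, by linarith, hη2, by linarith, by linarith, fun k => (hη1 k).le⟩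

theorem lt_of_forall_mul_lt {n : ℕ} (hn : 0 < n) {t : Fin n → ℝ} (ht : ∀ i, 0 < t i)
    (hsum : 1 ≤ ∑ i, t i) {s : ℝ}
    (hs : ∀ k, s * (1 + t k) < n + 1 + ∑ i, max 0 (t k - t i)) : s < n := by
  have : Nonempty (Fin n) := ⟨⟨0, hn⟩⟩
  obtain ⟨k, hk⟩ := Finite.exists_max t
  have h1 : ∑ i, max 0 (t k - t i) = n * t k - ∑ i, t i := by
    rw [Finset.sum_congr rfl fun i _ => max_eq_right (sub_nonneg.2 (hk i))]
    simp
  have h2 := hs k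
  rw [h1] at h2
  have h3 : s * (1 + t k) < n * (1 + t k) := by linarith
  exact lt_of_mul_lt_mul_right h3 (by linarith [ht k])

theorem eventually_const_mul_rpow_le (C : ℝ) {e ε : ℝ} (he : e < 0) (hε : 0 < ε) :
    ∀ᶠ Q : ℕ in atTop, C * (Q : ℝ) ^ e ≤ ε := by
  have h1 : Tendsto (fun Q : ℕ => C * (Q : ℝ) ^ e) atTop (nhds (C * 0)) := by
    refine Tendsto.const_mul C ?_
    have := (tendsto_rpow_neg_atTop (neg_pos.2 he)).comp tendsto_natCast_atTop_atTop
    simpa [Function.comp_def] using this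
  rw [mul_zero] at h1
  filter_upwards [h1.eventually (gt_mem_nhds hε)] with Q hQ using hQ.le

/-- Mass transference for boxes centred at shifted rational points. -/
theorem le_dimH_limsup_of_boxes {n : ℕ} (hn : 0 < n) {t : Fin n → ℝ} (ht : ∀ i, 0 < t i)
    (hsum : 1 ≤ ∑ i, t i) {b : Fin n → ℕ → ℝ} (hb : FitsInCells t b)
    {E : ℕ → Set (Fin n → ℝ)} (hE : ∀ q, 0 < q → ∀ p ∈ gridPts n q,
      (univ.pi fun i => Icc (cellPt b q p i - boxRad t q i) (cellPt b q p i + boxRad t q i)) ⊆ E q)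
    {s : ℝ} (hs0 : 0 < s) (hs : ∀ k, s * (1 + t k) < n + 1 + ∑ i, max 0 (t k - t i)) :
    ENNReal.ofReal s ≤ dimH (limsup E atTop) := by
  have hsn := lt_of_forall_mul_lt hn ht hsum hs
  obtain ⟨s', σ, hss, hs'n, hσ0, hσ1, hk⟩ := exists_perturbed_exponents hsn hs
  obtain ⟨c, hc, hcσ⟩ := exists_sum_min_eq ht hσ0 (hσ1.trans hsum)
  set a : Fin n → ℝ := fun i => min (t i) c with ha
  have ha1 : ∀ i, a i ≤ 1 := fun i =>
    (Finset.single_le_sum (fun k _ => le_min (ht k).le hc.le) (Finset.mem_univ i)).trans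
      (hcσ.le.trans hσ1)
  obtain ⟨e, he0, heσ, hes⟩ : ∃ e, 0 < e ∧ e ≤ σ / 2 ∧ e ≤ (s' - s) / 2 :=
    ⟨min (σ / 2) ((s' - s) / 2), lt_min (by linarith) (by linarith), min_le_left _ _,
      min_le_right _ _⟩
  obtain ⟨θ, hθ0, hθ1, hθs⟩ : ∃ θ, 0 < θ ∧ θ ≤ 1 ∧ θ ≤ n - s :=
    ⟨min 1 (n - s), lt_min one_pos (by linarith), min_le_left _ _, min_le_right _ _⟩
  refine le_dimH_limsup_of_localisation hs0 hsn.le E fun g hg hgc hg0 ε hε N => ?_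
  have hgi : Integrable g := hg.integrable_of_hasCompactSupport hgc
  obtain ⟨M, hM'⟩ := hgc.exists_bound_of_continuous hg
  have hM : ∀ x, g x ≤ M := fun x => (le_abs_self _).trans (hM' x)
  set ω : ℝ := ε / (4 * 6 ^ n) with hω
  have hω0 : 0 < ω := by positivity
  obtain ⟨d, hd, hdω⟩ := Metric.uniformContinuous_iff.1
    (hgc.uniformContinuous_of_continuous hg) ω hω0
  have hω1 : 2 * ω * 6 ^ n = ε / 2 := by
    rw [hω]
    field_simp
    norm_num
  have hω2 : 2 * ω ≤ ε / 2 := by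
    rw [← hω1]
    exact le_mul_of_one_le_right (by positivity) (one_le_pow₀ (by norm_num))
  have hlarge : ∀ᶠ Q : ℕ in atTop, 1 < Q ∧ (Q : ℝ) ^ (-1 : ℝ) < d ∧
      M * (2 * n * 6 ^ n) * (Q : ℝ) ^ (-θ) ≤ ε / 2 ∧
      M * (2 * 5 ^ n) * (Q : ℝ) ^ (-e) ≤ ε / 2 ∧
      M * (∏ i, (64 * (2 : ℝ) ^ (1 + t i))) * (Q : ℝ) ^ (e - (s' - s)) ≤ ε := by
    refine (eventually_gt_atTop 1).and (Eventually.and ?_ (Eventually.and ?_ (Eventually.and ?_ ?_)))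
    · filter_upwards [eventually_const_mul_rpow_le 1 (by norm_num : (-1 : ℝ) < 0) (half_pos hd)]
        with Q hQ
      linarith
    · exact eventually_const_mul_rpow_le _ (by linarith) (half_pos hε)
    · exact eventually_const_mul_rpow_le _ (by linarith) (half_pos hε)
    · exact eventually_const_mul_rpow_le _ (by linarith) hε
  obtain ⟨N', hN'⟩ := eventually_atTop.1 hlarge
  obtain ⟨Q, hNQ, hQ0, 𝒬, h𝒬, hcard1, hcard2⟩ :=
    exists_many_primes (β := σ - e) (by linarith) (by linarith) (max N N')
  obtain ⟨hQ1, hQd, hQ2, hQ3, hQ4⟩ := hN' Q ((le_max_right _ _).trans hNQ)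
  have hblock : IsPrimeBlock Q (σ - e) 𝒬 :=
    ⟨hQ0, fun q hq => (h𝒬 q hq).1, fun q hq => (h𝒬 q hq).2.1, fun q hq => (h𝒬 q hq).2.2, hcard1,
      hcard2⟩
  have hQpos : (0 : ℝ) < Q := by exact_mod_cast hQ0
  have hpos : ∀ q ∈ 𝒬, 0 < q := fun q hq => (h𝒬 q hq).1.pos
  have hosc : ∀ x y, dist x y ≤ 1 / (Q : ℝ) → |g x - g y| ≤ ω := by
    intro x y hxy
    rw [Real.rpow_neg_one, ← one_div] at hQd
    exact (hdω (hxy.trans_lt hQd)).le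
  refine ⟨blockDensity t b a Q 𝒬, blockDensity_continuous _ _ _ _ _,
    blockDensity_nonneg t b a hpos, ⋃ q ∈ 𝒬, ⋃ p ∈ goodPts b a Q 𝒬 q, univ.pi fun i =>
      Icc (cellPt b q p i - boxRad t q i) (cellPt b q p i + boxRad t q i), ?_, ?_, ?_, ?_, ?_⟩
  · exact 𝒬.isCompact_biUnion fun q _ => (goodPts b a Q 𝒬 q).isCompact_biUnion fun p _ =>
      isCompact_univ_pi fun i => isCompact_Icc
  · refine iUnion₂_subset fun q hq => iUnion₂_subset fun p hp => ?_
    refine (hE q (hpos q hq) p (Finset.mem_sdiff.1 hp).1).trans ?_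
    exact subset_biUnion_of_mem (u := E)
      (show N ≤ q from (le_max_left _ _).trans (hNQ.trans (hblock.ge q hq)))
  · intro x hx
    refine mul_eq_zero_of_right _ (Finset.sum_eq_zero fun q hq => Finset.sum_eq_zero fun p hp => ?_)
    refine mul_eq_zero_of_right _ ?_
    by_contra h
    refine hx (mem_iUnion₂.2 ⟨q, hq, mem_iUnion₂.2 ⟨p, hp, fun i _ => ?_⟩⟩)
    have h1 := abs_le.1 (abs_sub_le_of_boxTent_ne_zero (boxRad_pos t (hpos q hq)) h i)
    exact ⟨by linarith, by linarith⟩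
  · intro x r hr hr1
    have hrs : 0 ≤ r ^ s := by positivity
    rcases le_total r (1 / Q) with hrQ | hrQ
    · have h1 := hblock.setIntegral_le_of_small hQ1 ht b hs'n hss.le hc.le hcσ hσ1 hk hg hg0 hM x
        hr hrQ
      have h2 : 0 ≤ ∫ y in Metric.closedBall x r, g y := integral_nonneg hg0
      have h3 : σ - (σ - e) - (s' - s) = e - (s' - s) := by ring
      rw [h3, ← mul_assoc] at h1
      have h4 := mul_le_mul_of_nonneg_right hQ4 hrs
      linarith
    · refine (hblock.setIntegral_le hb a hg hgi hg0 hM hosc hθ0 hθ1 hθs x hrQ hr1).trans ?_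
      gcongr
      rw [one_div, Real.inv_rpow hQpos.le, ← Real.rpow_neg hQpos.le, ← mul_assoc, hω1]
      linarith
  · refine le_trans ?_ (hblock.le_setIntegral hb ha1 hg hgi hg0 hM hosc)
    have h1 : σ - e - ∑ i, a i = -e := by
      rw [ha, hcσ]
      ring
    rw [h1, ← mul_assoc]
    linarith

theorem tauK_pos {n : ℕ} {τψ τφ : Fin n → ℝ} (hτψ : ∀ i, 0 < τψ i) (hτφ : ∀ i, 0 < τφ i)
    (j i : Fin n) : 0 < tauK τψ τφ j i := by
  unfold tauK
  split_ifs
  · exact add_pos (hτψ j) (hτφ j)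
  · exact hτψ i

theorem dimExpr_eq {n : ℕ} (τψ τφ : Fin n → ℝ) (j k : Fin n) :
    dimExpr n τψ τφ j k =
      (n + 1 + ∑ i, max 0 (tauK τψ τφ j k - tauK τψ τφ j i)) / (1 + tauK τψ τφ j k) := by
  classical
  unfold dimExpr
  congr 1
  rw [add_assoc ((n : ℝ) + 1)]
  congr 1
  rw [← Finset.sum_erase_add _ _ (Finset.mem_univ j)]
  congr 1
  · have : (Finset.univ.filter fun i => i ≠ j ∧ τψ i < tauK τψ τφ j k) =
        (Finset.univ.erase j).filter fun i => τψ i < tauK τψ τφ j k := by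
      ext i
      simp
    rw [Finset.filter_congr_decidable, this, Finset.sum_filter]
    refine Finset.sum_congr rfl fun i hi => ?_
    rw [show tauK τψ τφ j i = τψ i from if_neg (Finset.ne_of_mem_erase hi)]
    split_ifs with h
    · exact (max_eq_right (by linarith)).symm
    · exact (max_eq_left (by linarith)).symm
  · rw [show tauK τψ τφ j j = τψ j + τφ j from if_pos rfl, sub_sub]

/-- The relative position of a box inside `Rplus` in its grid cell. -/
noncomputable def rplusPos {n : ℕ} (τψ τφ : Fin n → ℝ) (j i : Fin n) (q : ℕ) : ℝ :=
  if i = j then (2 - (q : ℝ) ^ (-(τφ j))) * (q : ℝ) ^ (-(τψ j)) / 2 else (q : ℝ) ^ (-(τψ i)) / 2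

theorem rplusPos_fitsInCells {n : ℕ} {τψ τφ : Fin n → ℝ} (hτψ : ∀ i, 0 < τψ i)
    (hτφ : ∀ i, 0 < τφ i) (j : Fin n) : FitsInCells (tauK τψ τφ j) (rplusPos τψ τφ j) := by
  intro i q hq
  have hq0 : (0 : ℝ) < q := by exact_mod_cast hq
  have hq1 : (1 : ℝ) ≤ q := by exact_mod_cast hq
  have hψ0 : 0 < (q : ℝ) ^ (-(τψ i)) := Real.rpow_pos_of_pos hq0 _
  have hψ1 : (q : ℝ) ^ (-(τψ i)) ≤ 1 :=
    Real.rpow_le_one_of_one_le_of_nonpos hq1 (by linarith [hτψ i])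
  unfold tauK rplusPos
  split_ifs with h
  · subst h
    have hφ0 : 0 < (q : ℝ) ^ (-(τφ i)) := Real.rpow_pos_of_pos hq0 _
    have hφ1 : (q : ℝ) ^ (-(τφ i)) ≤ 1 :=
      Real.rpow_le_one_of_one_le_of_nonpos hq1 (by linarith [hτφ i])
    rw [neg_add, Real.rpow_add hq0]
    have h1 := mul_le_mul_of_nonneg_left hφ1 hψ0.le
    have h2 := mul_pos hψ0 hφ0
    constructor <;> nlinarith
  · constructor <;> linarith

theorem pi_Icc_subset_Rplus {n : ℕ} (τψ τφ : Fin n → ℝ) (j : Fin n) {q : ℕ} (hq : 0 < q)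
    (p : Fin n → ℕ) :
    (univ.pi fun i => Icc
      (cellPt (rplusPos τψ τφ j) q p i - boxRad (tauK τψ τφ j) q i)
      (cellPt (rplusPos τψ τφ j) q p i + boxRad (tauK τψ τφ j) q i)) ⊆
    Rplus n (fun i q => (q : ℝ) ^ (-(τψ i))) (fun i q => (q : ℝ) ^ (-(τφ i))) j
      (fun i => (p i : ℤ)) q := by
  intro x hx i _
  have hq0 : (0 : ℝ) < q := by exact_mod_cast hq
  have hψ0 : 0 < (q : ℝ) ^ (-(τψ i)) / q := div_pos (Real.rpow_pos_of_pos hq0 _) hq0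
  have hxi := hx i (mem_univ i)
  simp only [boxRad_eq _ hq, cellPt, rplusPos, tauK] at hxi
  by_cases h : i = j
  · subst h
    have hφ0 : 0 < (q : ℝ) ^ (-(τφ i)) := Real.rpow_pos_of_pos hq0 _
    simp only [if_true] at hxi ⊢
    rw [neg_add, Real.rpow_add hq0] at hxi
    set ψ := (q : ℝ) ^ (-(τψ i))
    set φ := (q : ℝ) ^ (-(τφ i))
    have h1 : 0 < φ * (ψ / q) := mul_pos hφ0 hψ0
    have e1 : ((p i : ℝ) + (2 - φ) * ψ / 2) / q = p i / q + (2 - φ) * ψ / (2 * q) := by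
      field_simp
    have e2 : ψ * φ / 4 / q = φ * (ψ / q) / 4 := by ring
    have e3 : φ * ψ / (2 * q) = φ * (ψ / q) / 2 := by
      field_simp
    rw [e1, e2] at hxi
    rw [e3]
    push_cast
    exact ⟨by linarith [hxi.1], by linarith [hxi.2]⟩
  · simp only [if_neg h] at hxi ⊢
    rw [add_div, div_right_comm, div_right_comm _ (4 : ℝ)] at hxi
    push_cast
    exact ⟨by linarith [hxi.1], by linarith [hxi.2]⟩

theorem stmt18 (n : ℕ) (hn : 0 < n) (τψ τφ : Fin n → ℝ)
    (hτψ : ∀ i, 0 < τψ i) (hτφ : ∀ i, 0 < τφ i)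
    (hsum : 1 ≤ ∑ i, τψ i) (j : Fin n) :
    ENNReal.ofReal (⨅ k, dimExpr n τψ τφ j k) ≤
      dimH (Wtilde n (fun i q => (q : ℝ) ^ (-(τψ i))) (fun i q => (q : ℝ) ^ (-(τφ i))) j) := by
  have ht := tauK_pos hτψ hτφ j
  have htsum : 1 ≤ ∑ i, tauK τψ τφ j i := by
    refine hsum.trans (Finset.sum_le_sum fun i _ => ?_)
    unfold tauK
    split_ifs with h
    · rw [h]
      linarith [hτφ j]
    · exact le_rfl
  have key : ∀ s, 0 < s → s < ⨅ k, dimExpr n τψ τφ j k → ENNReal.ofReal s ≤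
      dimH (Wtilde n (fun i q => (q : ℝ) ^ (-(τψ i))) (fun i q => (q : ℝ) ^ (-(τφ i))) j) := by
    intro s hs0 hs
    refine le_dimH_limsup_of_boxes hn ht htsum (rplusPos_fitsInCells hτψ hτφ j)
      (fun q hq p hp => ?_) hs0 fun k => ?_
    · refine (pi_Icc_subset_Rplus τψ τφ j hq p).trans ?_
      refine subset_biUnion_of_mem (u := fun p : Fin n → ℤ => Rplus n
        (fun i q => (q : ℝ) ^ (-(τψ i))) (fun i q => (q : ℝ) ^ (-(τφ i))) j p q) ?_
      refine (pi_norm_le_iff_of_nonneg (by positivity)).2 fun i => ?_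
      have : p i < q := Finset.mem_range.1 (Fintype.mem_piFinset.1 hp i)
      rw [Int.norm_natCast]
      exact_mod_cast this.le
    · have h1 := hs.trans_le (ciInf_le (finite_range _).bddBelow k)
      rwa [dimExpr_eq, lt_div_iff₀ (by linarith [ht k])] at h1
  by_contra! h
  have hfin := (h.trans ENNReal.ofReal_lt_top).ne
  obtain ⟨s, hs1, hs2⟩ := exists_between ((ENNReal.lt_ofReal_iff_toReal_lt hfin).1 h)
  have hs0 := ENNReal.toReal_nonneg.trans_lt hs1
  exact absurd (key s hs0 hs2) (not_le.2 ((ENNReal.lt_ofReal_iff_toReal_lt hfin).2 hs1))
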